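/- Let M be a smooth hypersurface of R^{n+1} and a ∈ [0,n). Then for every φ ∈ C^1_c(M): (n−a)∫_M φ²/|x|^a dV + a∫_M ((x/|x|)·ν_M)² φ²/|x|^a dV ≤ (∫_M φ²/|x|^a dV)^{1/2} (∫_M (4|∇_T φ|² + |Hφ|²)/|x|^{a−2} dV)^{1/2}. -/

import Mathlib

open MeasureTheory
open scoped RealInnerProductSpace

noncomputable section

/-- Ambient Euclidean space `ℝ^{n+1}`. -/
abbrev Eu (n : ℕ) := EuclideanSpace ℝ (Fin (n + 1))

/-- A smooth `n`-dimensional hypersurface of `ℝ^{n+1}`, described by its carrier set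
together with a smooth unit normal field; locally it is a regular level set of a
smooth function. -/
structure Hypersurface (n : ℕ) where
  carrier : Set (Eu n)
  nu : Eu n → Eu n
  smooth_nu : ContDiff ℝ (⊤ : ℕ∞) nu
  unit_nu : ∀ x ∈ carrier, ‖nu x‖ = 1
  locally_level_set : ∀ x ∈ carrier, ∃ U : Set (Eu n), IsOpen U ∧ x ∈ U ∧
    ∃ f : Eu n → ℝ, ContDiff ℝ (⊤ : ℕ∞) f ∧
      carrier ∩ U = {y ∈ U | f y = 0} ∧
      (∀ y ∈ U, gradient f y ≠ 0) ∧
      (∀ y ∈ carrier ∩ U, nu y = ‖gradient f y‖⁻¹ • gradient f y)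

variable {n : ℕ}

/-- The `i`-th tangential derivative `δ_i φ = ∂_i φ − ν^i ∑_j (∂_j φ) ν^j`. -/
def tderiv (ν : Eu n → Eu n) (i : Fin (n + 1)) (φ : Eu n → ℝ) (x : Eu n) : ℝ :=
  fderiv ℝ φ x (EuclideanSpace.single i 1)
    - ν x i * ∑ j, fderiv ℝ φ x (EuclideanSpace.single j 1) * ν x j

/-- The tangential gradient `∇_T φ = ∇φ − (∇φ·ν)ν`. -/
def tgrad (ν : Eu n → Eu n) (φ : Eu n → ℝ) (x : Eu n) : Eu n :=
  gradient φ x - ⟪gradient φ x, ν x⟫ • ν x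

/-- The tangential divergence `div_T Z = ∑ i δ_i Z^i`. -/
def tdiv (ν : Eu n → Eu n) (Z : Eu n → Eu n) (x : Eu n) : ℝ :=
  ∑ i, tderiv ν i (fun y => Z y i) x

/-- The mean curvature `H = div_T ν` (sum of the principal curvatures). -/
def meanCurv (M : Hypersurface n) (x : Eu n) : ℝ := tdiv M.nu M.nu x

/-- The Laplace–Beltrami operator `Δφ = div_T (∇_T φ)`. -/
def lapBel (ν : Eu n → Eu n) (φ : Eu n → ℝ) (x : Eu n) : ℝ := tdiv ν (tgrad ν φ) x

/-- The surface measure on `M`: the `n`-dimensional Hausdorff measure restricted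
to the carrier of `M`. -/
def surfMeasure (M : Hypersurface n) : Measure (Eu n) :=
  (μH[(n : ℝ)]).restrict M.carrier

/-- `C^1` functions with compact support in a set `S`: ambient `C^1` functions
vanishing on `S` outside a compact subset `K ⊆ S`. -/
def C1cOn (S : Set (Eu n)) (φ : Eu n → ℝ) : Prop :=
  ContDiff ℝ 1 φ ∧ ∃ K : Set (Eu n), IsCompact K ∧ K ⊆ S ∧ ∀ x ∈ S, x ∉ K → φ x = 0


abbrev Vn (n : ℕ) := EuclideanSpace ℝ (Fin n)

/-- Graph data over a hyperplane. -/
structure GraphData (n : ℕ) where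
  e : Eu n
  he : ‖e‖ = 1
  ι : Vn n →ₗᵢ[ℝ] Eu n
  P : Eu n →L[ℝ] Vn n
  hP : ∀ x, ι (P x) = x - ⟪e, x⟫ • e
  hPι : ∀ v, P (ι v) = v
  hPe : P e = 0
  hadj : ∀ v x, ⟪ι v, x⟫ = ⟪v, P x⟫
  u : Vn n → ℝ
  hu : ContDiff ℝ (⊤ : ℕ∞) u
  hc : HasCompactSupport u

theorem exists_frame (e : Eu n) (he : ‖e‖ = 1) :
    ∃ (ι : Vn n →ₗᵢ[ℝ] Eu n) (P : Eu n →L[ℝ] Vn n), (∀ x, ι (P x) = x - ⟪e, x⟫ • e) ∧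
      (∀ v, P (ι v) = v) ∧ P e = 0 ∧ ∀ v x, ⟪ι v, x⟫ = ⟪v, P x⟫ := by
  have hne : e ≠ 0 := by intro h; simp [h] at he
  have : Fact (Module.finrank ℝ (Eu n) = n + 1) := ⟨by simp⟩
  let b := OrthonormalBasis.fromOrthogonalSpanSingleton (𝕜 := ℝ) n hne
  let ι : Vn n →ₗᵢ[ℝ] Eu n := (Submodule.subtypeₗᵢ _).comp b.repr.symm.toLinearIsometry
  let P : Eu n →L[ℝ] Vn n := ContinuousLinearMap.adjoint ι.toContinuousLinearMap
  have hadj : ∀ v x, ⟪ι v, x⟫ = ⟪v, P x⟫ := fun v x =>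
    (ContinuousLinearMap.adjoint_inner_right ι.toContinuousLinearMap v x).symm
  have hPι : ∀ v, P (ι v) = v := by
    intro v
    apply ext_inner_left ℝ
    intro w
    rw [← hadj, ι.inner_map_map]
  have hι : ∀ v, ⟪e, ι v⟫ = 0 := by
    intro v
    have : ι v ∈ (Submodule.span ℝ {e})ᗮ := (b.repr.symm v).2
    exact Submodule.mem_orthogonal_singleton_iff_inner_right.1 this
  have hPe : P e = 0 := by
    apply ext_inner_left ℝ
    intro w
    rw [← hadj, real_inner_comm, hι, inner_zero_right]
  refine ⟨ι, P, ?_, hPι, hPe, hadj⟩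
  intro x
  have hx : x - ⟪e, x⟫ • e ∈ (Submodule.span ℝ {e})ᗮ := by
    rw [Submodule.mem_orthogonal_singleton_iff_inner_right]
    simp [inner_sub_right, inner_smul_right, he]
  have : ι (b.repr ⟨_, hx⟩) = x - ⟪e, x⟫ • e := by simp [ι]
  have h2 : P (x - ⟪e, x⟫ • e) = b.repr ⟨_, hx⟩ := by
    have h4 := hPι (b.repr ⟨_, hx⟩)
    rwa [this] at h4
  have h3 : P (x - ⟪e, x⟫ • e) = P x := by simp [hPe]
  rw [← h3, h2, this]

namespace GraphData

variable (G : GraphData n)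

theorem inner_e_ι (v : Vn n) : ⟪G.e, G.ι v⟫ = 0 := by
  rw [real_inner_comm, G.hadj, G.hPe, inner_zero_right]

/-- The parametrization. -/
def F (y : Vn n) : Eu n := G.ι y + G.u y • G.e

theorem contDiff_F : ContDiff ℝ (⊤ : ℕ∞) G.F :=
  (G.ι.contDiff).add (G.hu.smul contDiff_const)

theorem P_F (y : Vn n) : G.P (G.F y) = y := by
  simp [F, G.hPι, G.hPe]

/-- Derivative of the parametrization. -/
def dF (y : Vn n) : Vn n →L[ℝ] Eu n :=
  G.ι.toContinuousLinearMap + (fderiv ℝ G.u y).smulRight G.e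

theorem dF_apply (y v : Vn n) : G.dF y v = G.ι v + (fderiv ℝ G.u y v) • G.e := by
  simp [dF]

theorem hasFDerivAt_u (y : Vn n) : HasFDerivAt G.u (fderiv ℝ G.u y) y :=
  (G.hu.differentiable (by simp) y).hasFDerivAt

theorem hasFDerivAt_F (y : Vn n) : HasFDerivAt G.F (G.dF y) y := by
  unfold F dF
  exact (G.ι.toContinuousLinearMap.hasFDerivAt).add ((G.hasFDerivAt_u y).smul_const G.e)

theorem hasStrictFDerivAt_F (y : Vn n) : HasStrictFDerivAt G.F (G.dF y) y :=
  (G.contDiff_F.contDiffAt).hasStrictFDerivAt' (G.hasFDerivAt_F y) (by simp)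

theorem norm_P_le (x : Eu n) : ‖G.P x‖ ≤ ‖x‖ := by
  have h1 : ‖G.P x‖ = ‖G.ι (G.P x)‖ := (G.ι.norm_map _).symm
  have h2 : ‖G.ι (G.P x)‖ ^ 2 = ‖x‖ ^ 2 - ⟪G.e, x⟫ ^ 2 := by
    rw [G.hP, ← real_inner_self_eq_norm_sq, ← real_inner_self_eq_norm_sq]
    simp only [inner_sub_left, inner_sub_right, inner_smul_left, inner_smul_right,
      real_inner_self_eq_norm_sq G.e, G.he, real_inner_comm G.e x]
    simp; ring
  rw [h1]
  apply le_of_sq_le_sq _ (norm_nonneg _)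
  rw [h2]; nlinarith [sq_nonneg ⟪G.e, x⟫]

theorem P_dF (y v : Vn n) : G.P (G.dF y v) = v := by
  simp [dF_apply, G.hPι, G.hPe]

theorem norm_le_dF (y v : Vn n) : ‖v‖ ≤ ‖G.dF y v‖ := by
  simpa [P_dF] using G.norm_P_le (G.dF y v)

theorem norm_sub_le_F (y z : Vn n) : ‖y - z‖ ≤ ‖G.F y - G.F z‖ := by
  have := G.norm_P_le (G.F y - G.F z)
  rwa [map_sub, P_F, P_F] at this

theorem isClosedEmbedding_F : Topology.IsClosedEmbedding G.F :=
  Function.LeftInverse.isClosedEmbedding (f := G.P) (fun y => G.P_F y) G.P.continuous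
    G.contDiff_F.continuous

theorem exists_lipschitz_F : ∃ K, LipschitzWith K G.F := by
  obtain ⟨C, hC⟩ := ContDiff.lipschitzWith_of_hasCompactSupport G.hc G.hu (by simp)
  have h2 : LipschitzWith (C * ‖G.e‖₊) (fun y => G.u y • G.e) := by
    apply LipschitzWith.of_dist_le_mul
    intro x y
    rw [dist_eq_norm, ← sub_smul, norm_smul]
    have := hC.dist_le_mul x y
    rw [Real.dist_eq] at this
    push_cast
    rw [Real.norm_eq_abs, G.he]; simpa using this
  exact ⟨_, G.ι.lipschitz.add h2⟩

instance haar_Vn : (μH[(n : ℝ)] : Measure (Vn n)).IsAddHaarMeasure := by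
  have h : Module.finrank ℝ (Vn n) = n := by simp
  have := MeasureTheory.isAddHaarMeasure_hausdorffMeasure (E := Vn n)
  rwa [h] at this

/-- The area density. -/
def J (y : Vn n) : ℝ := (G.dF y).toLinearMap.normDet

theorem measure_dF (y : Vn n) (s : Set (Vn n)) :
    μH[(n : ℝ)] (G.dF y '' s) = ENNReal.ofReal (G.J y) * μH[(n : ℝ)] s := by
  have h : Module.finrank ℝ (Vn n) = n := by simp
  have := (G.dF y).toLinearMap.hausdorffMeasure_image s
  rw [h] at this
  exact this

theorem measure_F_compare (y : Vn n) {c : NNReal} (hc : 0 < c) :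
    ∀ᶠ r in nhdsWithin (0 : ℝ) (Set.Ioi 0),
      μH[(n : ℝ)] (G.F '' Metric.closedBall y r) ≤
        ((1 + c : NNReal) : ENNReal) ^ (n : ℝ) *
          (ENNReal.ofReal (G.J y) * μH[(n : ℝ)] (Metric.closedBall y r)) ∧
      ENNReal.ofReal (G.J y) * μH[(n : ℝ)] (Metric.closedBall y r) ≤
        ((1 + c : NNReal) : ENNReal) ^ (n : ℝ) *
          μH[(n : ℝ)] (G.F '' Metric.closedBall y r) := by
  obtain ⟨s, hs, happ⟩ := (G.hasStrictFDerivAt_F y).approximates_deriv_on_nhds (Or.inr hc)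
  obtain ⟨δ, hδ, hδs⟩ := Metric.mem_nhds_iff.1 hs
  filter_upwards [Ioo_mem_nhdsGT hδ] with r hr
  have hB : Metric.closedBall y r ⊆ s := (Metric.closedBall_subset_ball hr.2).trans hδs
  have happ' := happ.mono_set hB
  rw [← G.measure_dF]
  set B := Metric.closedBall y r
  constructor
  · have h1 : LipschitzOnWith (1 + c) (G.F ∘ G.P) (G.dF y '' B) := by
      apply LipschitzOnWith.of_dist_le_mul
      rintro _ ⟨a, ha, rfl⟩ _ ⟨b, hb, rfl⟩
      simp only [Function.comp, P_dF, dist_eq_norm]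
      have := happ' a ha b hb
      have h3 := G.norm_le_dF y (a - b)
      rw [← map_sub]
      have h4 := norm_le_norm_add_norm_sub (G.dF y (a - b)) (G.F a - G.F b)
      have h5 : (c : ℝ) * ‖a - b‖ ≤ c * ‖G.dF y (a - b)‖ := by gcongr
      push_cast
      linarith [norm_sub_rev (G.F a - G.F b) (G.dF y (a - b))]
    have := h1.hausdorffMeasure_image_le (d := n) (by positivity)
    rw [Set.image_image] at this
    simpa [P_dF] using this
  · have h1 : LipschitzOnWith (1 + c) (G.dF y ∘ G.P) (G.F '' B) := by
      apply LipschitzOnWith.of_dist_le_mul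
      rintro _ ⟨a, ha, rfl⟩ _ ⟨b, hb, rfl⟩
      simp only [Function.comp, P_F, dist_eq_norm]
      have := happ' a ha b hb
      have h3 := G.norm_sub_le_F a b
      rw [← map_sub]
      have h4 := norm_le_norm_add_norm_sub (G.F a - G.F b) (G.dF y (a - b)) 
      rw [norm_sub_rev] at this
      have h5 : (c : ℝ) * ‖a - b‖ ≤ c * ‖G.F a - G.F b‖ := by gcongr
      push_cast
      linarith [norm_sub_rev (G.F a - G.F b) (G.dF y (a - b))]
    have := h1.hausdorffMeasure_image_le (d := n) (by positivity)
    rw [Set.image_image] at this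
    simpa [P_F] using this

/-- The pulled back Hausdorff measure. -/
def ρ : Measure (Vn n) := (μH[(n : ℝ)] : Measure (Eu n)).comap G.F

theorem ρ_apply (s : Set (Vn n)) : G.ρ s = μH[(n : ℝ)] (G.F '' s) :=
  G.isClosedEmbedding_F.measurableEmbedding.comap_apply _ s

theorem exists_ρ_le : ∃ C : NNReal, ∀ s, G.ρ s ≤ (C : ENNReal) * μH[(n : ℝ)] s := by
  obtain ⟨K, hK⟩ := G.exists_lipschitz_F
  refine ⟨K ^ n, fun s => ?_⟩
  rw [ρ_apply]
  have := hK.hausdorffMeasure_image_le (d := n) (by positivity) s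
  simpa using this

instance : IsLocallyFiniteMeasure G.ρ := by
  obtain ⟨C, hC⟩ := G.exists_ρ_le
  constructor
  intro x
  refine ⟨Metric.ball x 1, Metric.ball_mem_nhds _ one_pos, (hC _).trans_lt ?_⟩
  exact ENNReal.mul_lt_top ENNReal.coe_lt_top Metric.isBounded_ball.measure_lt_top

theorem ρ_ac : G.ρ ≪ (μH[(n : ℝ)] : Measure (Vn n)) := by
  obtain ⟨C, hC⟩ := G.exists_ρ_le
  intro s hs
  have := hC s
  rw [hs, mul_zero] at this
  exact le_antisymm this (zero_le)

theorem le_of_forall_pow {x y : ENNReal} (hx : y ≠ ⊤)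
    (h : ∀ c : NNReal, 0 < c → x ≤ ((1 + c : NNReal) : ENNReal) ^ (n : ℝ) * y) : x ≤ y := by
  have h1 : Filter.Tendsto (fun c : NNReal => ((1 + c : NNReal) : ENNReal) ^ (n : ℝ) * y)
      (nhdsWithin 0 (Set.Ioi 0)) (nhds y) := by
    have : Filter.Tendsto (fun c : NNReal => (((1 + c) ^ n : NNReal) : ENNReal) * y)
      (nhdsWithin 0 (Set.Ioi 0)) (nhds ((((1 + 0) ^ n : NNReal) : ENNReal) * y)) := by
      apply ENNReal.Tendsto.mul_const _ (Or.inr hx)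
      apply ENNReal.tendsto_coe.2
      apply Filter.Tendsto.mono_left _ nhdsWithin_le_nhds
      exact (Continuous.tendsto (by fun_prop) 0)
    simpa using this
  exact ge_of_tendsto h1 (by filter_upwards [self_mem_nhdsWithin] with c hc using h c hc)

theorem ρ_eq : G.ρ = (μH[(n : ℝ)] : Measure (Vn n)).withDensity
    (fun y => ENNReal.ofReal (G.J y)) := by
  rw [← Measure.withDensity_rnDeriv_eq _ _ G.ρ_ac]
  apply withDensity_congr_ae
  filter_upwards [Besicovitch.ae_tendsto_rnDeriv G.ρ (μH[(n : ℝ)] : Measure (Vn n)),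
    Measure.rnDeriv_ne_top G.ρ (μH[(n : ℝ)] : Measure (Vn n))] with y hy hyt
  have hpos : ∀ r : ℝ, 0 < r → (μH[(n : ℝ)] (Metric.closedBall y r)) ≠ 0 := fun r hr =>
    (Metric.measure_closedBall_pos _ y hr).ne'
  have hfin : ∀ r : ℝ, (μH[(n : ℝ)] (Metric.closedBall y r)) ≠ ⊤ := fun r =>
    Metric.isBounded_closedBall.measure_lt_top.ne
  apply le_antisymm
  · apply le_of_forall_pow (n := n) ENNReal.ofReal_ne_top
    intro c hc
    apply le_of_tendsto hy
    filter_upwards [G.measure_F_compare y hc, self_mem_nhdsWithin] with r hr hr0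
    rw [ENNReal.div_le_iff (hpos r hr0) (hfin r), ρ_apply, mul_assoc]
    exact hr.1
  · apply le_of_forall_pow (n := n) hyt
    intro c hc
    refine ge_of_tendsto (ENNReal.Tendsto.const_mul hy (Or.inr (by simp))) ?_
    filter_upwards [G.measure_F_compare y hc, self_mem_nhdsWithin] with r hr hr0
    rw [← mul_div_assoc, ENNReal.le_div_iff_mul_le (Or.inl (hpos r hr0)) (Or.inl (hfin r)),
      ρ_apply]
    exact hr.2

end GraphData

namespace GraphData

variable (G : GraphData n)

theorem inner_e_e : ⟪G.e, G.e⟫ = 1 := by rw [real_inner_self_eq_norm_sq, G.he]; norm_num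

theorem inner_grad (y w : Vn n) : ⟪gradient G.u y, w⟫ = fderiv ℝ G.u y w := by
  simp [gradient]

theorem J_sq (y : Vn n) : G.J y ^ 2 = 1 + ‖gradient G.u y‖ ^ 2 := by
  have h := (G.dF y).normDet_sq
  have h2 : ((G.dF y).adjoint ∘L (G.dF y)).toLinearMap =
      LinearMap.transvection (fderiv ℝ G.u y).toLinearMap (gradient G.u y) := by
    ext1 v
    refine ext_inner_right ℝ fun w => ?_
    have h3 := G.inner_grad y w
    have h4 := G.inner_e_ι v
    have h5 := G.inner_e_ι w
    have h6 : ⟪G.ι v, G.e⟫ = 0 := by rw [real_inner_comm]; exact h4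
    have h7 := G.ι.inner_map_map v w
    have h8 := G.inner_e_e
    simp only [ContinuousLinearMap.coe_coe, ContinuousLinearMap.comp_apply,
      ContinuousLinearMap.adjoint_inner_left, dF_apply, LinearMap.transvection.apply,
      inner_add_left, inner_add_right, inner_smul_left, inner_smul_right, h3, h5, h6, h7, h8]
    simp [mul_comm]
  unfold ContinuousLinearMap.det at h
  rw [h2, LinearMap.transvection.det] at h
  have h9 := G.inner_grad y (gradient G.u y)
  rw [real_inner_self_eq_norm_sq] at h9
  rw [h9]
  exact h

theorem J_eq_sqrt (y : Vn n) : G.J y = √(1 + ‖gradient G.u y‖ ^ 2) := by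
  rw [← J_sq, Real.sqrt_sq]
  exact LinearMap.normDet_nonneg _

theorem J_pos (y : Vn n) : 0 < G.J y := by
  rw [J_eq_sqrt]; positivity

theorem contDiff_J : ContDiff ℝ (⊤ : ℕ∞) G.J := by
  have : G.J = fun y => √(1 + ‖gradient G.u y‖ ^ 2) := funext G.J_eq_sqrt
  rw [this]
  have h1 : ContDiff ℝ (⊤ : ℕ∞) (gradient G.u) := by
    unfold gradient
    exact ((InnerProductSpace.toDual ℝ (Vn n)).symm.contDiff).comp (G.hu.fderiv_right (by simp))
  exact ContDiff.sqrt (contDiff_const.add (h1.norm_sq ℝ)) (fun y => by positivity)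

theorem norm_P_sq (x : Eu n) : ‖G.P x‖ ^ 2 = ‖x‖ ^ 2 - ⟪G.e, x⟫ ^ 2 := by
  have h1 : ‖G.P x‖ = ‖G.ι (G.P x)‖ := (G.ι.norm_map _).symm
  rw [h1, G.hP, ← real_inner_self_eq_norm_sq, ← real_inner_self_eq_norm_sq]
  simp only [inner_sub_left, inner_sub_right, inner_smul_left, inner_smul_right, G.inner_e_e,
    real_inner_comm G.e x]
  simp
  ring

theorem J_eq_inv {y : Vn n} {N : Eu n} (hN : ‖N‖ = 1) (hp : ∀ v, ⟪N, G.dF y v⟫ = 0)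
    (hpos : 0 < ⟪N, G.e⟫) : G.J y = ⟪N, G.e⟫⁻¹ := by
  have h1 : gradient G.u y = -(⟪N, G.e⟫⁻¹ • G.P N) := by
    refine ext_inner_right ℝ fun v => ?_
    rw [inner_grad, inner_neg_left, inner_smul_left]
    have := hp v
    rw [dF_apply, inner_add_right, inner_smul_right, real_inner_comm, G.hadj,
      real_inner_comm] at this
    simp only [conj_trivial]
    field_simp
    linarith
  have h2 : G.J y ^ 2 = ⟪N, G.e⟫⁻¹ ^ 2 := by
    rw [J_sq, h1, norm_neg, norm_smul, mul_pow, norm_P_sq, hN, real_inner_comm N G.e]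
    rw [Real.norm_eq_abs, sq_abs]
    field_simp
    ring
  exact (sq_eq_sq₀ (G.J_pos y).le (by positivity)).1 h2
end GraphData

theorem exists_equiv (e : Eu n) (he : ‖e‖ = 1) (L : Eu n →L[ℝ] ℝ) (hL : L e ≠ 0) :
    ∃ E : Eu n ≃L[ℝ] Eu n, ∀ z, E z = z + (L z - ⟪e, z⟫) • e := by
  have hee : ⟪e, e⟫ = 1 := by rw [real_inner_self_eq_norm_sq, he]; norm_num
  let A : Eu n →L[ℝ] Eu n := ContinuousLinearMap.id ℝ _ + (L - innerSL ℝ e).smulRight e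
  let B : Eu n →L[ℝ] Eu n :=
    ContinuousLinearMap.id ℝ _ - (L e)⁻¹ • (L - innerSL ℝ e).smulRight e
  refine ⟨ContinuousLinearEquiv.equivOfInverse A B ?_ ?_, fun z => by
    rw [ContinuousLinearEquiv.equivOfInverse_apply]; simp [A]⟩
  · intro z
    simp [A, B, he, inner_add_right, inner_smul_right]
    match_scalars
    · ring
    · field_simp; ring
  · intro z
    simp [A, B, he, inner_sub_right, inner_smul_right]
    match_scalars
    · ring
    · field_simp; ring

/-- A graph chart of `M` over `U`. -/
structure IsChart (M : Hypersurface n) (G : GraphData n) (U : Set (Eu n)) : Prop where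
  isOpen : IsOpen U
  eq : M.carrier ∩ U = Set.range G.F ∩ U
  pos : ∀ x ∈ U, 0 < ⟪M.nu x, G.e⟫
  perp : ∀ y, G.F y ∈ U → ∀ v, ⟪M.nu (G.F y), G.dF y v⟫ = 0

theorem exists_chart (M : Hypersurface n) (x0 : Eu n) (hx0 : x0 ∈ M.carrier) :
    ∃ G U, IsChart M G U ∧ x0 ∈ U := by
  obtain ⟨U0, hU0, hxU0, f, hf, hMU, hgr, hnu⟩ := M.locally_level_set x0 hx0
  set e := M.nu x0 with he_def
  have he : ‖e‖ = 1 := M.unit_nu x0 hx0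
  have hee : ⟪e, e⟫ = 1 := by rw [real_inner_self_eq_norm_sq, he]; norm_num
  obtain ⟨ι, P, hP, hPι, hPe, hadj⟩ := exists_frame e he
  have heι : ∀ v, ⟪e, ι v⟫ = 0 := fun v => by
    rw [real_inner_comm, hadj, hPe, inner_zero_right]
  let Ψ : Eu n → Eu n := fun x => x + (f x - ⟪e, x⟫) • e
  have hΨ : ContDiff ℝ (⊤ : ℕ∞) Ψ := by
    have : ContDiff ℝ (⊤ : ℕ∞) (fun x : Eu n => ⟪e, x⟫) := contDiff_const.inner ℝ contDiff_id
    exact contDiff_id.add ((hf.sub this).smul contDiff_const)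
  have hfd : ∀ x, HasFDerivAt f (fderiv ℝ f x) x := fun x =>
    (hf.differentiable (by simp) x).hasFDerivAt
  have hderiv : ∀ x, fderiv ℝ f x e ≠ 0 → ∃ E : Eu n ≃L[ℝ] Eu n,
      HasFDerivAt Ψ (E : Eu n →L[ℝ] Eu n) x := by
    intro x hx
    obtain ⟨E, hE⟩ := exists_equiv e he (fderiv ℝ f x) hx
    refine ⟨E, ?_⟩
    have : (E : Eu n →L[ℝ] Eu n) = ContinuousLinearMap.id ℝ _ +
        (fderiv ℝ f x - innerSL ℝ e).smulRight e := by
      ext1 z; simp [hE]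
    rw [this]
    exact (hasFDerivAt_id x).add
      (((hfd x).sub (innerSL ℝ e).hasFDerivAt).smul_const e)
  have hx0e : fderiv ℝ f x0 e ≠ 0 := by
    have h1 := hnu x0 ⟨hx0, hxU0⟩
    have h2 : fderiv ℝ f x0 e = ⟪gradient f x0, e⟫ := by simp [gradient]
    have h3 : gradient f x0 = ‖gradient f x0‖ • e := by
      rw [he_def, h1, smul_smul, mul_inv_cancel₀ (norm_ne_zero_iff.2 (hgr x0 hxU0)), one_smul]
    rw [h2, h3, inner_smul_left, hee]
    simpa using hgr x0 hxU0
  obtain ⟨E0, hE0⟩ := hderiv x0 hx0e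
  let H := (hΨ.contDiffAt (x := x0)).toOpenPartialHomeomorph Ψ hE0 (by simp)
  have hHx0 : x0 ∈ H.source := ContDiffAt.mem_toOpenPartialHomeomorph_source _ _ _
  have hHcoe : ∀ x, H x = Ψ x := fun x => rfl
  have hPΨ : ∀ x, P (Ψ x) = P x := fun x => by simp [Ψ, hPe]
  have heΨ : ∀ x, ⟪e, Ψ x⟫ = f x := fun x => by
    simp [Ψ, inner_add_right, inner_smul_right, he]
  have hdec : ∀ x, x = ι (P x) + ⟪e, x⟫ • e := fun x => by rw [hP]; simp
  let Ω : Set (Eu n) := U0 ∩ {x | fderiv ℝ f x e ≠ 0} ∩ {x | 0 < ⟪M.nu x, e⟫}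
  have hΩ : IsOpen Ω := by
    refine (hU0.inter ?_).inter ?_
    · have : Continuous fun x => fderiv ℝ f x e :=
        (hf.continuous_fderiv (by simp)).clm_apply continuous_const
      exact isOpen_ne_fun this continuous_const
    · have : Continuous fun x => ⟪M.nu x, e⟫ := M.smooth_nu.continuous.inner continuous_const
      exact isOpen_lt continuous_const this
  have hx0Ω : x0 ∈ Ω := ⟨⟨hxU0, hx0e⟩, by
    change 0 < ⟪M.nu x0, e⟫
    rw [← he_def, hee]; exact one_pos⟩
  let T : Set (Eu n) := H.target ∩ H.symm ⁻¹' Ω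
  have hT : IsOpen T := H.isOpen_inter_preimage_symm hΩ
  have hTs : ∀ z ∈ T, ContDiffAt ℝ (⊤ : ℕ∞) H.symm z := by
    rintro z ⟨hz1, hz2⟩
    obtain ⟨E, hE⟩ := hderiv (H.symm z) hz2.1.2
    exact H.contDiffAt_symm hz1 hE hΨ.contDiffAt
  have hfx0 : f x0 = 0 := by
    have : x0 ∈ M.carrier ∩ U0 := ⟨hx0, hxU0⟩
    rw [hMU] at this; exact this.2
  have hΨι : ∀ x, f x = 0 → Ψ x = ι (P x) := fun x hx => by
    rw [hdec (Ψ x), hPΨ, heΨ, hx]; simp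
  have hy0T : ι (P x0) ∈ T := by
    rw [← hΨι x0 hfx0]
    refine ⟨H.map_source hHx0, ?_⟩
    have : H.symm (Ψ x0) = x0 := H.left_inv hHx0
    simp only [Set.mem_preimage, this]
    exact hx0Ω
  have hB : ι ⁻¹' T ∈ nhds (P x0) := (hT.preimage ι.continuous).mem_nhds hy0T
  obtain ⟨r, hr, hrB⟩ := Metric.nhds_basis_closedBall.mem_iff.1 hB
  let χ : ContDiffBump (P x0) := ⟨r / 2, r, by positivity, by linarith⟩
  let u : Vn n → ℝ := fun y => χ y * ⟪e, H.symm (ι y)⟫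
  have hus : tsupport u ⊆ Metric.closedBall (P x0) r := by
    have := tsupport_mul_subset_left (f := (χ : Vn n → ℝ)) (g := fun y => ⟪e, H.symm (ι y)⟫)
    rwa [χ.tsupport_eq] at this
  have hu : ContDiff ℝ (⊤ : ℕ∞) u := by
    rw [contDiff_iff_contDiffAt]
    intro y
    by_cases hy : y ∈ tsupport u
    · have h1 := hTs _ (hrB (hus hy))
      have h2 : ContDiffAt ℝ (⊤ : ℕ∞) (fun y => H.symm (ι y)) y :=
        h1.comp y ι.contDiff.contDiffAt
      exact χ.contDiff.contDiffAt.mul (contDiffAt_const.inner ℝ h2)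
    · have : u =ᶠ[nhds y] fun _ => 0 := notMem_tsupport_iff_eventuallyEq.1 hy
      exact contDiffAt_const.congr_of_eventuallyEq this
  have huc : HasCompactSupport u :=
    (isCompact_closedBall _ _).of_isClosed_subset (isClosed_tsupport _) hus
  let G : GraphData n := ⟨e, he, ι, P, hP, hPι, hPe, hadj, u, hu, huc⟩
  let U : Set (Eu n) := (H.source ∩ Ω) ∩ P ⁻¹' Metric.ball (P x0) (r / 2)
  have hUo : IsOpen U := (H.open_source.inter hΩ).inter (Metric.isOpen_ball.preimage P.continuous)
  have hMU' : ∀ x ∈ U, (x ∈ M.carrier ↔ f x = 0) := by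
    rintro x ⟨⟨-, ⟨hx, -⟩, -⟩, -⟩
    have := Set.ext_iff.1 hMU x
    simp only [Set.mem_inter_iff, hx, and_true, Set.mem_ofPred_eq, true_and] at this
    exact this
  have huball : ∀ y ∈ Metric.ball (P x0) (r / 2), u y = ⟪e, H.symm (ι y)⟫ := by
    intro y hy
    have : χ y = 1 := χ.one_of_mem_closedBall (Metric.ball_subset_closedBall hy)
    simp [u, this]
  have key : ∀ x ∈ U, (x ∈ M.carrier ↔ x ∈ Set.range G.F) := by
    intro x hx
    rw [hMU' x hx]
    constructor
    · intro h
      refine ⟨P x, ?_⟩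
      have h1 : H.symm (ι (P x)) = x := by
        rw [← hΨι x h]; exact H.left_inv hx.1.1
      change ι (P x) + u (P x) • e = x
      rw [huball _ hx.2, h1]
      exact (hdec x).symm
    · rintro ⟨y, rfl⟩
      have hy : G.P (G.F y) = y := G.P_F y
      have hyb : y ∈ Metric.ball (P x0) (r / 2) := by
        have := hx.2
        rw [Set.mem_preimage] at this
        rwa [show P (G.F y) = y from hy] at this
      have hyT : ι y ∈ T := hrB (Metric.ball_subset_closedBall
        (Metric.ball_subset_ball (by linarith) hyb))
      have h1 : Ψ (H.symm (ι y)) = ι y := H.right_inv hyT.1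
      have h2 : f (H.symm (ι y)) = 0 := by rw [← heΨ, h1, heι]
      have h3 : P (H.symm (ι y)) = y := by rw [← hPΨ, h1, hPι]
      have h4 : H.symm (ι y) = G.F y := by
        rw [hdec (H.symm (ι y)), h3]
        change _ = ι y + u y • e
        rw [huball y hyb]
      rw [← h4]; exact h2
  refine ⟨G, U, ⟨hUo, ?_, ?_, ?_⟩, ⟨⟨hHx0, hx0Ω⟩, ?_⟩⟩
  · ext x
    constructor
    · rintro ⟨h1, h2⟩; exact ⟨(key x h2).1 h1, h2⟩
    · rintro ⟨h1, h2⟩; exact ⟨(key x h2).2 h1, h2⟩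
  · exact fun x hx => hx.1.2.2
  · intro y hy v
    have h1 : (f ∘ G.F) =ᶠ[nhds y] fun _ => 0 := by
      have := G.contDiff_F.continuous.continuousAt.preimage_mem_nhds (hUo.mem_nhds hy)
      filter_upwards [this] with y' hy'
      exact (hMU' _ hy').1 ((key _ hy').2 ⟨y', rfl⟩)
    have h2 : HasFDerivAt (f ∘ G.F) (fderiv ℝ f (G.F y) ∘L G.dF y) y :=
      (hfd _).comp y (G.hasFDerivAt_F y)
    have h3 : fderiv ℝ f (G.F y) ∘L G.dF y = 0 :=
      (h2.congr_of_eventuallyEq h1.symm).unique (hasFDerivAt_const 0 y)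
    have h4 : fderiv ℝ f (G.F y) (G.dF y v) = 0 := by
      have := congrArg (fun L => L v) h3
      simpa using this
    rw [hnu _ ⟨(key _ hy).2 ⟨y, rfl⟩, hy.1.2.1.1⟩, inner_smul_left]
    have : ⟪gradient f (G.F y), G.dF y v⟫ = fderiv ℝ f (G.F y) (G.dF y v) := by simp [gradient]
    rw [this, h4, mul_zero]
  · simpa using hr

theorem tdiv_eq (ν Z : Eu n → Eu n) (x : Eu n) (hZ : DifferentiableAt ℝ Z x) :
    tdiv ν Z x = LinearMap.trace ℝ _ (fderiv ℝ Z x).toLinearMap - ⟪fderiv ℝ Z x (ν x), ν x⟫ := by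
  have h1 : ∀ i v, fderiv ℝ (fun y => Z y i) x v = (fderiv ℝ Z x v) i := by
    intro i v
    have := ((EuclideanSpace.proj i : Eu n →L[ℝ] ℝ).hasFDerivAt.comp x
      hZ.hasFDerivAt).fderiv
    change fderiv ℝ (fun y => Z y i) x = _ at this
    rw [this]; simp
  have h2 : ∀ i, ∑ j, (fderiv ℝ Z x (EuclideanSpace.single j 1)) i * ν x j =
      (fderiv ℝ Z x (ν x)) i := by
    intro i
    have h3 : ν x = ∑ j, ν x j • EuclideanSpace.single j (1:ℝ) := by
      ext k; simp [Finset.sum_apply, Pi.single_apply]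
    conv_rhs => rw [h3, map_sum]
    simp [mul_comm]
  rw [LinearMap.trace_eq_sum_inner _ (EuclideanSpace.basisFun _ ℝ)]
  simp only [tdiv, tderiv, h1, h2]
  rw [Finset.sum_sub_distrib]
  congr 1
  simp [EuclideanSpace.inner_single_left]

namespace IsChart
variable {M : Hypersurface n} {G : GraphData n} {U : Set (Eu n)}

theorem F_mem (h : IsChart M G U) {y : Vn n} (hy : G.F y ∈ U) : G.F y ∈ M.carrier :=
  (h.eq.symm ▸ (⟨⟨y, rfl⟩, hy⟩ : G.F y ∈ Set.range G.F ∩ U) : G.F y ∈ M.carrier ∩ U).1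

theorem J_eq (h : IsChart M G U) {y : Vn n} (hy : G.F y ∈ U) : G.J y = ⟪M.nu (G.F y), G.e⟫⁻¹ :=
  G.J_eq_inv (M.unit_nu _ (h.F_mem hy)) (h.perp y hy) (h.pos _ hy)

theorem J_mul (h : IsChart M G U) {y : Vn n} (hy : G.F y ∈ U) : G.J y * ⟪M.nu (G.F y), G.e⟫ = 1 := by
  rw [h.J_eq hy, inv_mul_cancel₀ (h.pos _ hy).ne']

theorem dF_P (h : IsChart M G U) {y : Vn n} (hy : G.F y ∈ U) (x : Eu n) :
    G.dF y (G.P x) = x - (G.J y * ⟪x, M.nu (G.F y)⟫) • G.e := by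
  have h1 := h.perp y hy (G.P x)
  have h2 := h.J_mul hy
  rw [G.dF_apply, G.hP] at *
  simp only [inner_add_right, inner_sub_right, inner_smul_right] at h1
  have h3 : fderiv ℝ G.u y (G.P x) = ⟪G.e, x⟫ - G.J y * ⟪x, M.nu (G.F y)⟫ := by
    rw [real_inner_comm x] at h1
    linear_combination G.J y * h1 + (⟪G.e, x⟫ - fderiv ℝ G.u y (G.P x)) * h2
  rw [h3]
  module

theorem eventually_mem (h : IsChart M G U) {y : Vn n} (hy : G.F y ∈ U) :
    ∀ᶠ y' in nhds y, G.F y' ∈ U :=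
  G.contDiff_F.continuous.continuousAt.preimage_mem_nhds (h.isOpen.mem_nhds hy)

theorem hasFDerivAt_nuF (_h : IsChart M G U) (y : Vn n) :
    HasFDerivAt (fun y => M.nu (G.F y)) (fderiv ℝ M.nu (G.F y) ∘L G.dF y) y :=
  ((M.smooth_nu.differentiable (by simp) _).hasFDerivAt).comp y (G.hasFDerivAt_F y)

theorem inner_dnu (h : IsChart M G U) {y : Vn n} (hy : G.F y ∈ U) (v : Vn n) :
    ⟪fderiv ℝ M.nu (G.F y) (G.dF y v), M.nu (G.F y)⟫ = 0 := by
  have h1 := (h.hasFDerivAt_nuF y).inner ℝ (h.hasFDerivAt_nuF y)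
  have h2 : (fun y => ⟪M.nu (G.F y), M.nu (G.F y)⟫) =ᶠ[nhds y] fun _ => (1 : ℝ) := by
    filter_upwards [h.eventually_mem hy] with y' hy'
    rw [real_inner_self_eq_norm_sq, M.unit_nu _ (h.F_mem hy')]; norm_num
  have h3 := (h1.congr_of_eventuallyEq h2.symm).unique (hasFDerivAt_const 1 y)
  have h4 := congrArg (fun L => L v) h3
  simp at h4
  rw [real_inner_comm] at h4
  linarith

theorem symm_dnu (h : IsChart M G U) {y : Vn n} (hy : G.F y ∈ U) (v w : Vn n) :
    ⟪fderiv ℝ M.nu (G.F y) (G.dF y v), G.dF y w⟫ =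
      ⟪fderiv ℝ M.nu (G.F y) (G.dF y w), G.dF y v⟫ := by
  have key : ∀ v w, ⟪fderiv ℝ M.nu (G.F y) (G.dF y v), G.dF y w⟫ =
      - (fderiv ℝ (fderiv ℝ G.u) y v w * ⟪M.nu (G.F y), G.e⟫) := by
    intro v w
    have h0 : HasFDerivAt (fun y' => G.dF y' w)
        (((fderiv ℝ (fderiv ℝ G.u) y).flip w).smulRight G.e) y := by
      have e1 : (fun y' => G.dF y' w) = fun y' => G.ι w + (fderiv ℝ G.u y' w) • G.e := by
        ext1 y'; rw [G.dF_apply]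
      rw [e1]
      have e2 : HasFDerivAt (fderiv ℝ G.u) (fderiv ℝ (fderiv ℝ G.u) y) y :=
        ((G.hu.fderiv_right (m := (⊤ : ℕ∞)) (by simp)).differentiable (by simp) y).hasFDerivAt
      have e3 := (e2.clm_apply (hasFDerivAt_const w y))
      have e4 : HasFDerivAt (fun y' => fderiv ℝ G.u y' w) ((fderiv ℝ (fderiv ℝ G.u) y).flip w) y := by
        simpa using e3
      exact (e4.smul_const G.e).const_add _
    have h1 := (h.hasFDerivAt_nuF y).inner ℝ h0
    have h2 : (fun y => ⟪M.nu (G.F y), G.dF y w⟫) =ᶠ[nhds y] fun _ => (0 : ℝ) := by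
      filter_upwards [h.eventually_mem hy] with y' hy'
      exact h.perp y' hy' w
    have h3 := (h1.congr_of_eventuallyEq h2.symm).unique (hasFDerivAt_const 0 y)
    have h4 := congrArg (fun L => L v) h3
    simp [inner_smul_right] at h4
    linarith
  rw [key, key]
  have := (G.hu.contDiffAt (x := y)).isSymmSndFDerivAt (by
    rw [minSmoothness_of_isRCLikeNormedField]; exact WithTop.coe_le_coe.2 (le_top : (2 : ℕ∞) ≤ ⊤))
  rw [this v w]

theorem trace_eq (h : IsChart M G U) {y : Vn n} (hy : G.F y ∈ U) (L : Eu n →L[ℝ] Eu n) :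
    LinearMap.trace ℝ _ L.toLinearMap - ⟪L (M.nu (G.F y)), M.nu (G.F y)⟫ =
      LinearMap.trace ℝ _ (G.P ∘L L ∘L G.dF y).toLinearMap -
        ⟪L (G.dF y (G.P (M.nu (G.F y)))), M.nu (G.F y)⟫ := by
  have h1 : LinearMap.trace ℝ _ (G.P ∘L L ∘L G.dF y).toLinearMap =
      LinearMap.trace ℝ _ (L ∘L G.dF y ∘L G.P).toLinearMap :=
    LinearMap.trace_comp_comm' (R := ℝ) (L ∘L G.dF y).toLinearMap G.P.toLinearMap
  have h2 : (L ∘L G.dF y ∘L G.P).toLinearMap = L.toLinearMap -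
      (innerSL ℝ (G.J y • M.nu (G.F y))).toLinearMap.smulRight (L G.e) := by
    ext1 x
    simp only [ContinuousLinearMap.coe_coe, ContinuousLinearMap.comp_apply, h.dF_P hy]
    simp [real_inner_comm]
  rw [h1, h2, map_sub, LinearMap.trace_smulRight, h.dF_P hy]
  have h3 : ⟪M.nu (G.F y), M.nu (G.F y)⟫ = 1 := by
    rw [real_inner_self_eq_norm_sq, M.unit_nu _ (h.F_mem hy)]; norm_num
  simp only [h3, map_sub, map_smul, inner_sub_left, inner_smul_left]
  simp [real_inner_comm]

end IsChart

namespace IsChart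
variable {M : Hypersurface n} {G : GraphData n} {U : Set (Eu n)}

/-- The pulled back weighted tangential field. -/
def pull (M : Hypersurface n) (G : GraphData n) (Z : Eu n → Eu n) (y : Vn n) : Vn n :=
  G.J y • G.P (Z (G.F y) - ⟪Z (G.F y), M.nu (G.F y)⟫ • M.nu (G.F y))

theorem contDiff_pull (M : Hypersurface n) (G : GraphData n) {Z : Eu n → Eu n}
    (hZ : ContDiff ℝ 1 Z) : ContDiff ℝ 1 (pull M G Z) := by
  have hF : ContDiff ℝ 1 G.F := G.contDiff_F.of_le (by simp)
  have h1 : ContDiff ℝ 1 (fun y => Z (G.F y)) := hZ.comp hF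
  have h2 : ContDiff ℝ 1 (fun y => M.nu (G.F y)) := (M.smooth_nu.of_le (by simp)).comp hF
  have h3 : ContDiff ℝ 1 G.J := G.contDiff_J.of_le (by simp)
  exact h3.smul (G.P.contDiff.comp (h1.sub ((h1.inner ℝ h2).smul h2)))

/-- The integrand in the divergence theorem. -/
def dv (M : Hypersurface n) (Z : Eu n → Eu n) (x : Eu n) : ℝ :=
  tdiv M.nu Z x - meanCurv M x * ⟪Z x, M.nu x⟫

theorem trace_pull (h : IsChart M G U) {Z : Eu n → Eu n} (hZ : ContDiff ℝ 1 Z) {y : Vn n}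
    (hy : G.F y ∈ U) :
    LinearMap.trace ℝ _ (fderiv ℝ (pull M G Z) y).toLinearMap = G.J y * dv M Z (G.F y) := by
  have hZd : HasFDerivAt Z (fderiv ℝ Z (G.F y)) (G.F y) :=
    (hZ.differentiable (by simp) _).hasFDerivAt
  set A : Vn n →L[ℝ] Eu n := fderiv ℝ Z (G.F y) ∘L G.dF y with hA
  set B : Vn n →L[ℝ] Eu n := fderiv ℝ M.nu (G.F y) ∘L G.dF y with hB
  set N := M.nu (G.F y) with hN
  set z := Z (G.F y) with hz
  set s := ⟪z, N⟫ with hs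
  have dA : HasFDerivAt (fun y => Z (G.F y)) A y := hZd.comp y (G.hasFDerivAt_F y)
  have dB : HasFDerivAt (fun y => M.nu (G.F y)) B y := h.hasFDerivAt_nuF y
  have hc := h.pos _ hy
  have dJ : HasFDerivAt G.J (-(G.J y ^ 2) • (innerSL ℝ G.e ∘L B)) y := by
    have h1 := dB.inner ℝ (hasFDerivAt_const G.e y)
    have h2 := (hasDerivAt_inv hc.ne').comp_hasFDerivAt y h1
    have h3 : G.J =ᶠ[nhds y] ((fun t => t⁻¹) ∘ fun t => ⟪M.nu (G.F t), G.e⟫) := by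
      filter_upwards [h.eventually_mem hy] with y' hy'
      exact h.J_eq hy'
    refine (h2.congr_of_eventuallyEq h3).congr_fderiv ?_
    ext1 v
    rw [h.J_eq hy]
    simp [real_inner_comm]
  have dY : HasFDerivAt (pull M G Z) (G.J y • (G.P ∘L A)
      - (G.J y) • (innerSL ℝ N ∘L A).smulRight (G.P N)
      - (G.J y) • (innerSL ℝ z ∘L B).smulRight (G.P N)
      - (G.J y * s) • (G.P ∘L B)
      - (G.J y ^ 2) • (innerSL ℝ G.e ∘L B).smulRight (G.P (z - s • N))) y := by
    have h1 := dJ.smul (G.P.hasFDerivAt.comp y (dA.sub ((dA.inner ℝ dB).smul dB)))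
    refine h1.congr_fderiv ?_
    ext1 v
    simp only [_root_.add_apply, _root_.sub_apply,
      _root_.smul_apply, ContinuousLinearMap.smulRight_apply,
      ContinuousLinearMap.comp_apply, innerSL_apply_apply,
      fderivInnerCLM_apply, ContinuousLinearMap.prod_apply, map_sub, map_add, map_smul,
      Pi.sub_apply, Function.comp_apply, Pi.smul_apply', ← hN, ← hz, ← hs,
      real_inner_comm N]
    module
  have hk : ∀ L : Vn n →L[ℝ] Vn n, HasFDerivAt (pull M G Z) L y →
    LinearMap.trace ℝ _ (fderiv ℝ (pull M G Z) y).toLinearMap =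
      LinearMap.trace ℝ _ L.toLinearMap := fun L hL => by rw [hL.fderiv]
  rw [hk _ dY]
  have hsr : ∀ (l : Vn n →L[ℝ] ℝ) (w : Vn n), LinearMap.trace ℝ _ (l.smulRight w).toLinearMap
      = l w := fun l w => LinearMap.trace_smulRight l.toLinearMap w
  have t1 := h.trace_eq hy (fderiv ℝ Z (G.F y))
  have t2 := h.trace_eq hy (fderiv ℝ M.nu (G.F y))
  have t3 := h.inner_dnu hy (G.P N)
  have hNN : ⟪N, N⟫ = 1 := by
    rw [real_inner_self_eq_norm_sq, M.unit_nu _ (h.F_mem hy)]; norm_num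
  have t4 : ⟪z, B (G.P N)⟫ = - (G.J y * ⟪G.e, B (G.P (z - s • N))⟫) := by
    have e0 : G.dF y (G.P (z - s • N)) = z - s • N := by
      rw [h.dF_P hy, ← hN, inner_sub_left, inner_smul_left, hNN]; simp [hs]
    have e1 := h.symm_dnu hy (G.P N) (G.P (z - s • N))
    rw [e0] at e1
    have e2 := h.dF_P hy N
    rw [← hN, hNN] at e2
    have e3 := h.inner_dnu hy (G.P (z - s • N))
    rw [e0] at e3
    rw [e2] at e1 t3
    rw [hB]
    simp only [ContinuousLinearMap.comp_apply]
    rw [e0, e2]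
    simp only [inner_sub_right, inner_smul_right, ← hN] at e1 t3 e3
    rw [real_inner_comm _ z, real_inner_comm _ G.e]
    rw [t3, e3] at e1
    linarith
  have t5 := tdiv_eq M.nu Z (G.F y) hZd.differentiableAt
  have t6 := tdiv_eq M.nu M.nu (G.F y) (M.smooth_nu.differentiable (by simp) _)
  simp only [ContinuousLinearMap.toLinearMap_sub, ContinuousLinearMap.toLinearMap_smul, map_sub, map_smul, hsr,
    ContinuousLinearMap.comp_apply, innerSL_apply_apply]
  rw [t4]
  simp only [dv, meanCurv]
  rw [t5, t6, t1, t2, t3, ← hN, ← hz, ← hs, real_inner_comm _ N]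
  simp only [smul_eq_mul, hA, hB, ContinuousLinearMap.comp_apply, map_sub, map_smul,
    inner_sub_right, inner_smul_right]
  ring
end IsChart

theorem integral_trace_eq_zero {Y : Vn n → Vn n} (hY : ContDiff ℝ 1 Y) (hc : HasCompactSupport Y) :
    Integrable (fun y => LinearMap.trace ℝ _ (fderiv ℝ Y y).toLinearMap)
      (μH[(n : ℝ)] : Measure (Vn n)) ∧
    ∫ y, LinearMap.trace ℝ _ (fderiv ℝ Y y).toLinearMap ∂(μH[(n : ℝ)] : Measure (Vn n)) = 0 := by
  let Yi : Fin n → Vn n → ℝ := fun i y => Y y i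
  have hYi : ∀ i, ContDiff ℝ 1 (Yi i) := fun i =>
    (EuclideanSpace.proj i : Vn n →L[ℝ] ℝ).contDiff.comp hY
  have hYic : ∀ i, HasCompactSupport (Yi i) := fun i =>
    hc.comp_left (g := fun v : Vn n => v i) rfl
  have h1 : ∀ y, LinearMap.trace ℝ _ (fderiv ℝ Y y).toLinearMap =
      ∑ i, fderiv ℝ (Yi i) y (EuclideanSpace.single i 1) := by
    intro y
    rw [LinearMap.trace_eq_sum_inner _ (EuclideanSpace.basisFun _ ℝ)]
    refine Finset.sum_congr rfl fun i _ => ?_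
    have := ((EuclideanSpace.proj i : Vn n →L[ℝ] ℝ).hasFDerivAt.comp y
      (hY.differentiable (by simp) y).hasFDerivAt).fderiv
    change fderiv ℝ (Yi i) y = _ at this
    rw [this]
    simp [EuclideanSpace.inner_single_left]
  have h2 : ∀ i v, Integrable (fun y => fderiv ℝ (Yi i) y v) (μH[(n : ℝ)] : Measure (Vn n)) := by
    intro i v
    refine Continuous.integrable_of_hasCompactSupport
      (((hYi i).continuous_fderiv (by simp)).clm_apply continuous_const) ?_
    exact ((hYic i).fderiv ℝ).comp_left (g := fun L : Vn n →L[ℝ] ℝ => L v) (by simp)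
  have h3 : ∀ i v, ∫ y, fderiv ℝ (Yi i) y v ∂(μH[(n : ℝ)] : Measure (Vn n)) = 0 := by
    intro i v
    have := integral_mul_fderiv_eq_neg_fderiv_mul_of_integrable (𝕜 := ℝ) (f := fun _ => (1 : ℝ))
      (g := Yi i) (v := v) (μ := (μH[(n : ℝ)] : Measure (Vn n))) (by simp)
      (by simpa using h2 i v)
      (by simpa using (hYi i).continuous.integrable_of_hasCompactSupport (hYic i))
      (fun x _ => differentiableAt_const _) (fun x _ => (hYi i).differentiable (by simp) x)
    simpa using this
  simp only [h1]
  refine ⟨integrable_finsetSum _ fun i _ => h2 i _, ?_⟩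
  rw [integral_finsetSum _ fun i _ => h2 i _]
  exact Finset.sum_eq_zero fun i _ => h3 i _

namespace IsChart
variable {M : Hypersurface n} {G : GraphData n} {U : Set (Eu n)}

theorem restrict_eq (h : IsChart M G U) :
    (surfMeasure M).restrict U = (G.ρ.map G.F).restrict U := by
  have h1 : G.ρ.map G.F = (μH[(n : ℝ)]).restrict (Set.range G.F) :=
    G.isClosedEmbedding_F.measurableEmbedding.map_comap _
  rw [h1, surfMeasure, Measure.restrict_restrict h.isOpen.measurableSet,
    Measure.restrict_restrict h.isOpen.measurableSet, Set.inter_comm U, h.eq, Set.inter_comm U]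

theorem integrable_iff (h : IsChart M G U) {g : Eu n → ℝ} (hg : ∀ x, x ∉ U → g x = 0) :
    Integrable g (surfMeasure M) ↔
      Integrable (fun y => G.J y * g (G.F y)) (μH[(n : ℝ)] : Measure (Vn n)) := by
  have h1 : U.indicator g = g := by
    ext x; by_cases hx : x ∈ U <;> simp [hx, hg]
  rw [← h1, integrable_indicator_iff h.isOpen.measurableSet, IntegrableOn, h.restrict_eq,
    ← IntegrableOn, ← integrable_indicator_iff h.isOpen.measurableSet, h1,
    G.isClosedEmbedding_F.measurableEmbedding.integrable_map_iff, G.ρ_eq,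
    integrable_withDensity_iff_integrable_smul' G.contDiff_J.continuous.measurable.ennreal_ofReal
      (by simp)]
  simp [ENNReal.toReal_ofReal (G.J_pos _).le]

theorem integral_eq (h : IsChart M G U) {g : Eu n → ℝ} (hg : ∀ x, x ∉ U → g x = 0) :
    ∫ x, g x ∂(surfMeasure M) = ∫ y, G.J y * g (G.F y) ∂(μH[(n : ℝ)] : Measure (Vn n)) := by
  have h1 : U.indicator g = g := by
    ext x; by_cases hx : x ∈ U <;> simp [hx, hg]
  rw [← h1, integral_indicator h.isOpen.measurableSet, h.restrict_eq,
    ← integral_indicator h.isOpen.measurableSet, h1,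
    G.isClosedEmbedding_F.measurableEmbedding.integral_map, G.ρ_eq,
    integral_withDensity_eq_integral_toReal_smul
      G.contDiff_J.continuous.measurable.ennreal_ofReal (by simp)]
  simp [ENNReal.toReal_ofReal (G.J_pos _).le]

theorem dv_eq_zero (M : Hypersurface n) {Z : Eu n → Eu n} (hZ : ContDiff ℝ 1 Z) {x : Eu n}
    (hx : x ∉ tsupport Z) : dv M Z x = 0 := by
  have h1 : Z =ᶠ[nhds x] fun _ => 0 := notMem_tsupport_iff_eventuallyEq.1 hx
  have h2 : fderiv ℝ Z x = 0 := by rw [h1.fderiv_eq]; simp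
  rw [dv, tdiv_eq _ _ _ (hZ.differentiable (by simp) x), h2, h1.eq_of_nhds]
  simp

theorem local_div (h : IsChart M G U) {Z : Eu n → Eu n} (hZ : ContDiff ℝ 1 Z)
    (hc : HasCompactSupport Z) (hs : tsupport Z ⊆ U) :
    Integrable (dv M Z) (surfMeasure M) ∧ ∫ x, dv M Z x ∂(surfMeasure M) = 0 := by
  have h0 : ∀ x, x ∉ U → dv M Z x = 0 := fun x hx => dv_eq_zero M hZ (fun h' => hx (hs h'))
  rw [h.integrable_iff h0, h.integral_eq h0]
  have hsup : ∀ y, G.F y ∉ tsupport Z → y ∉ tsupport (pull M G Z) := by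
    intro y hy
    rw [notMem_tsupport_iff_eventuallyEq] at hy ⊢
    filter_upwards [G.contDiff_F.continuous.continuousAt.eventually hy] with y' hy'
    have : Z (G.F y') = 0 := hy'
    simp [pull, this]
  have h1 : ∀ y, G.J y * dv M Z (G.F y) =
      LinearMap.trace ℝ _ (fderiv ℝ (pull M G Z) y).toLinearMap := by
    intro y
    by_cases hy : G.F y ∈ tsupport Z
    · exact (h.trace_pull hZ (hs hy)).symm
    · have h3 : pull M G Z =ᶠ[nhds y] fun _ => 0 := notMem_tsupport_iff_eventuallyEq.1 (hsup y hy)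
      rw [dv_eq_zero M hZ hy, h3.fderiv_eq]
      simp
  simp only [h1]
  refine integral_trace_eq_zero (contDiff_pull M G hZ) ?_
  refine (G.isClosedEmbedding_F.isCompact_preimage hc).of_isClosed_subset (isClosed_tsupport _) ?_
  intro y hy
  by_contra hy'
  exact hsup y hy' hy

/-- Tangential locality. -/
theorem fderiv_eq_zero (h : IsChart M G U) {E : Type*} [NormedAddCommGroup E] [NormedSpace ℝ E]
    {g : Eu n → E} {x : Eu n} (hx : x ∈ M.carrier) (hxU : x ∈ U) (hg : DifferentiableAt ℝ g x)
    (hg0 : ∀ᶠ x' in nhds x, x' ∈ M.carrier → g x' = 0) {z : Eu n} (hz : ⟪z, M.nu x⟫ = 0) :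
    fderiv ℝ g x z = 0 := by
  have h1 : x ∈ Set.range G.F ∩ U := h.eq ▸ ⟨hx, hxU⟩
  obtain ⟨⟨y, rfl⟩, -⟩ := h1
  have h2 : HasFDerivAt (g ∘ G.F) (fderiv ℝ g (G.F y) ∘L G.dF y) y :=
    hg.hasFDerivAt.comp y (G.hasFDerivAt_F y)
  have h3 : (g ∘ G.F) =ᶠ[nhds y] fun _ => 0 := by
    filter_upwards [h.eventually_mem hxU, G.contDiff_F.continuous.continuousAt.eventually hg0]
      with y' hy' hy''
    exact hy'' (h.F_mem hy')
  have h4 := (h2.congr_of_eventuallyEq h3.symm).unique (hasFDerivAt_const 0 y)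
  have h5 := congrArg (fun L => L (G.P z)) h4
  simp only [ContinuousLinearMap.comp_apply, h.dF_P hxU, hz] at h5
  simpa using h5
end IsChart

open IsChart

theorem tdiv_zero_of (M : Hypersurface n) {Z : Eu n → Eu n} (hZ : ContDiff ℝ 1 Z) {x : Eu n}
    (hx : x ∈ M.carrier) (h0 : ∀ᶠ x' in nhds x, x' ∈ M.carrier → Z x' = 0) :
    tdiv M.nu Z x = 0 := by
  obtain ⟨G, U, h, hxU⟩ := exists_chart M x hx
  have hd := hZ.differentiable (by simp) x
  rw [tdiv_eq _ _ _ hd]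
  have hNN : ⟪M.nu x, M.nu x⟫ = 1 := by
    rw [real_inner_self_eq_norm_sq, M.unit_nu _ hx]; norm_num
  have h1 : (fderiv ℝ Z x).toLinearMap =
      (innerSL ℝ (M.nu x)).toLinearMap.smulRight (fderiv ℝ Z x (M.nu x)) := by
    ext1 z
    have := h.fderiv_eq_zero hx hxU hd h0 (z := z - ⟪M.nu x, z⟫ • M.nu x) (by
      rw [inner_sub_left, inner_smul_left, hNN, real_inner_comm]; simp)
    rw [map_sub, map_smul, sub_eq_zero] at this
    simpa using this
  rw [h1, LinearMap.trace_smulRight]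
  simp [real_inner_comm]

theorem dv_add (M : Hypersurface n) {Z Z' : Eu n → Eu n} (hZ : ContDiff ℝ 1 Z)
    (hZ' : ContDiff ℝ 1 Z') (x : Eu n) : dv M (fun x => Z x + Z' x) x = dv M Z x + dv M Z' x := by
  have hd := hZ.differentiable (by simp) x
  have hd' := hZ'.differentiable (by simp) x
  simp only [dv]
  rw [tdiv_eq _ _ _ hd, tdiv_eq _ _ _ hd', tdiv_eq _ _ _ (hd.fun_add hd'), fderiv_fun_add hd hd']
  simp only [ContinuousLinearMap.toLinearMap_add, map_add, inner_add_left, _root_.add_apply]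
  ring

theorem dv_sum (M : Hypersurface n) {I : Type*} (s : Finset I) {Z : I → Eu n → Eu n}
    (hZ : ∀ i, ContDiff ℝ 1 (Z i)) (x : Eu n) :
    dv M (fun x => ∑ i ∈ s, Z i x) x = ∑ i ∈ s, dv M (Z i) x := by
  classical
  induction s using Finset.induction_on with
  | empty =>
    simp only [Finset.sum_empty]
    refine dv_eq_zero M contDiff_const ?_
    simp [tsupport, Function.support]
  | insert i s his ih =>
    simp only [Finset.sum_insert his]
    rw [dv_add M (hZ i) (ContDiff.sum fun j _ => hZ j), ih]

theorem measurableSet_carrier (M : Hypersurface n) : MeasurableSet M.carrier := by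
  choose G U hGU using fun x : M.carrier => exists_chart M x x.2
  obtain ⟨T, hT, hTU⟩ := TopologicalSpace.isOpen_iUnion_countable U (fun x => (hGU x).1.isOpen)
  have h1 : M.carrier = ⋃ i ∈ T, (Set.range (G i).F ∩ U i) := by
    have h2 : M.carrier ⊆ ⋃ i ∈ T, U i := by
      rw [hTU]
      exact fun x hx => Set.mem_iUnion.2 ⟨⟨x, hx⟩, (hGU ⟨x, hx⟩).2⟩
    refine (Set.inter_eq_left.2 h2).symm.trans ?_
    rw [Set.inter_iUnion₂]
    simp only [(hGU _).1.eq]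
  rw [h1]
  refine MeasurableSet.biUnion hT fun i _ => ?_
  exact ((G i).isClosedEmbedding_F.isClosed_range.measurableSet).inter (hGU i).1.isOpen.measurableSet

theorem global_div (M : Hypersurface n) {Z : Eu n → Eu n} (hZ : ContDiff ℝ 1 Z) {K : Set (Eu n)}
    (hK : IsCompact K) (hKM : K ⊆ M.carrier) (h0 : ∀ x ∈ M.carrier, x ∉ K → Z x = 0) :
    Integrable (dv M Z) (surfMeasure M) ∧ ∫ x, dv M Z x ∂(surfMeasure M) = 0 := by
  choose G U hGU using fun x : M.carrier => exists_chart M x x.2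
  let V : M.carrier → Set (Eu n) := fun x => U x ∩ Metric.ball x 1
  have hV : ∀ x, IsOpen (V x) := fun x => (hGU x).1.isOpen.inter Metric.isOpen_ball
  obtain ⟨t, ht⟩ := hK.elim_finite_subcover V hV
    (fun x hx => Set.mem_iUnion.2 ⟨⟨x, hKM hx⟩, (hGU _).2, by simp⟩)
  obtain ⟨χ, hχ⟩ := SmoothPartitionOfUnity.exists_isSubordinate (modelWithCornersSelf ℝ (Eu n))
    hK.isClosed (fun i : t => V i) (fun i => hV i) (by
      intro x hx
      obtain ⟨i, hi, hxi⟩ := Set.mem_iUnion₂.1 (ht hx)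
      exact Set.mem_iUnion.2 ⟨⟨i, hi⟩, hxi⟩)
  have hχs : ∀ i, ContDiff ℝ 1 (χ i : Eu n → ℝ) := fun i =>
    ((χ i).contMDiff.contDiff).of_le (by simp)
  let Zi : t → Eu n → Eu n := fun i x => χ i x • Z x
  have hZi : ∀ i, ContDiff ℝ 1 (Zi i) := fun i => (hχs i).smul hZ
  have hsupp : ∀ i, tsupport (Zi i) ⊆ V i := fun i =>
    (tsupport_smul_subset_left (χ i : Eu n → ℝ) Z).trans (hχ i)
  have hloc : ∀ i, Integrable (dv M (Zi i)) (surfMeasure M) ∧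
      ∫ x, dv M (Zi i) x ∂(surfMeasure M) = 0 := by
    intro i
    refine (hGU i).1.local_div (hZi i) ?_ ((hsupp i).trans Set.inter_subset_left)
    refine (isCompact_closedBall (i : Eu n) 1).of_isClosed_subset (isClosed_tsupport _) ?_
    exact (hsupp i).trans (Set.inter_subset_right.trans Metric.ball_subset_closedBall)
  have hsum : ContDiff ℝ 1 (fun x => ∑ i, Zi i x) := ContDiff.sum fun j _ => hZi j
  have hR : ∀ x ∈ M.carrier, Z x - ∑ i, Zi i x = 0 := by
    intro x hx
    by_cases hxK : x ∈ K
    · have := χ.sum_eq_one hxK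
      rw [finsum_eq_sum_of_fintype] at this
      simp only [Zi]
      rw [← Finset.sum_smul, this, one_smul, sub_self]
    · simp [Zi, h0 x hx hxK]
  have heq : ∀ x ∈ M.carrier, dv M Z x = ∑ i, dv M (Zi i) x := by
    intro x hx
    have e1 : Z = fun x => (Z x - ∑ i, Zi i x) + ∑ i, Zi i x := by ext1 x; simp
    have e2 : dv M (fun x => Z x - ∑ i, Zi i x) x = 0 := by
      rw [dv, tdiv_zero_of M (hZ.sub hsum) hx (Filter.Eventually.of_forall hR), hR x hx]
      simp
    conv_lhs => rw [e1]
    rw [dv_add M (hZ.sub hsum) hsum, e2, zero_add, dv_sum M _ hZi]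
  have hae : dv M Z =ᵐ[surfMeasure M] fun x => ∑ i, dv M (Zi i) x := by
    filter_upwards [ae_restrict_mem (measurableSet_carrier M)] with x hx
    exact heq x hx
  rw [integrable_congr hae, integral_congr_ae hae]
  refine ⟨integrable_finsetSum _ fun i _ => (hloc i).1, ?_⟩
  rw [integral_finsetSum _ fun i _ => (hloc i).1]
  exact Finset.sum_eq_zero fun i _ => (hloc i).2

theorem surf_finiteAt (M : Hypersurface n) {x : Eu n} (hx : x ∈ M.carrier) :
    (surfMeasure M).FiniteAtFilter (nhds x) := by
  obtain ⟨G, U, h, hxU⟩ := exists_chart M x hx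
  refine ⟨U ∩ Metric.ball x 1, (h.isOpen.inter Metric.isOpen_ball).mem_nhds ⟨hxU, by simp⟩, ?_⟩
  have h1 : surfMeasure M (U ∩ Metric.ball x 1) = (G.ρ.map G.F) (U ∩ Metric.ball x 1) := by
    rw [Set.inter_comm, ← Measure.restrict_apply Metric.isOpen_ball.measurableSet, h.restrict_eq,
      Measure.restrict_apply Metric.isOpen_ball.measurableSet]
  rw [h1, G.isClosedEmbedding_F.measurableEmbedding.map_apply]
  have h2 : IsCompact (G.F ⁻¹' (Metric.closedBall x 1)) :=
    G.isClosedEmbedding_F.isCompact_preimage (isCompact_closedBall x 1)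
  refine (measure_mono ?_).trans_lt h2.measure_lt_top
  exact Set.preimage_mono (Set.inter_subset_right.trans Metric.ball_subset_closedBall)

theorem weight_integrableOn (M : Hypersurface n) {a : ℝ} (ha : 0 ≤ a) (han : a < n) {K : Set (Eu n)}
    (hK : IsCompact K) (hKM : K ⊆ M.carrier) :
    IntegrableOn (fun x => ‖x‖ ^ (-a)) K (surfMeasure M) := by
  have hmeas : Measurable (fun x : Eu n => ‖x‖ ^ (-a)) := by fun_prop
  refine LocallyIntegrableOn.integrableOn_isCompact (fun x hx => ?_) hK
  suffices IntegrableAtFilter (fun x : Eu n => ‖x‖ ^ (-a)) (nhds x) (surfMeasure M) from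
    this.filter_mono nhdsWithin_le_nhds
  by_cases hx0 : x = 0
  · subst hx0
    obtain ⟨G, U, h, hxU⟩ := exists_chart M 0 (hKM hx)
    refine ⟨U ∩ Metric.ball 0 1, (h.isOpen.inter Metric.isOpen_ball).mem_nhds ⟨hxU, by simp⟩, ?_⟩
    have hms : MeasurableSet (U ∩ Metric.ball (0 : Eu n) 1) :=
      (h.isOpen.inter Metric.isOpen_ball).measurableSet
    rw [← integrable_indicator_iff hms, h.integrable_iff (by
      intro x hx; simp [hx])]
    have hF0 : G.F 0 = 0 := by
      have h1 : (0 : Eu n) ∈ Set.range G.F ∩ U := h.eq ▸ ⟨hKM hx, hxU⟩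
      obtain ⟨⟨y, hy⟩, -⟩ := h1
      have := G.P_F y
      rw [hy, map_zero] at this
      rw [this, hy]
    have hFy : ∀ y, ‖y‖ ≤ ‖G.F y‖ := fun y => by
      simpa [hF0] using G.norm_sub_le_F y 0
    obtain ⟨C, hC⟩ := (isCompact_closedBall (0 : Vn n) 1).exists_bound_of_continuousOn
      G.contDiff_J.continuous.continuousOn
    have hm2 : Measurable (fun y => G.J y *
        (U ∩ Metric.ball (0 : Eu n) 1).indicator (fun x => ‖x‖ ^ (-a)) (G.F y)) :=
      G.contDiff_J.continuous.measurable.mul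
        ((hmeas.indicator hms).comp G.contDiff_F.continuous.measurable)
    have hn : (0 : ℝ) < n := ha.trans_lt han
    have key : IntegrableOn (fun y => G.J y *
        (U ∩ Metric.ball (0 : Eu n) 1).indicator (fun x => ‖x‖ ^ (-a)) (G.F y))
        (Metric.ball 0 1) (μH[(n : ℝ)] : Measure (Vn n)) := by
      refine integrableOn_ball_of_norm_le_rpow (C := C) (α := a) ?_ ?_ ?_ hm2.aestronglyMeasurable
      · simp only [finrank_euclideanSpace, Fintype.card_fin]
        exact_mod_cast hn
      · simpa using han
      · have hno : NullSingletonClass (μH[(n : ℝ)] : Measure (Vn n)) := Measure.nullSingletonClass_hausdorff _ hn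
        have hne : ∀ᵐ y ∂((μH[(n : ℝ)] : Measure (Vn n)).restrict (Metric.ball 0 1)), y ≠ 0 :=
          ae_restrict_of_ae (by simp only [ae_iff, not_not]; exact measure_singleton 0)
        filter_upwards [hne, ae_restrict_mem Metric.isOpen_ball.measurableSet] with y hy hyb
        rw [norm_mul]
        have h1 := hC y (Metric.ball_subset_closedBall hyb)
        refine mul_le_mul h1 ?_ (norm_nonneg _) ((norm_nonneg _).trans h1)
        refine (norm_indicator_le_norm_self _ _).trans ?_
        rw [Real.norm_of_nonneg (by positivity)]
        exact Real.rpow_le_rpow_of_nonpos (norm_pos_iff.2 hy) (hFy y) (by linarith)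
    rw [← integrableOn_univ]
    refine key.of_forall_sdiff_eq_zero MeasurableSet.univ ?_
    rintro y ⟨-, hy⟩
    have : G.F y ∉ U ∩ Metric.ball (0 : Eu n) 1 := by
      rintro ⟨-, h2⟩
      apply hy
      rw [mem_ball_zero_iff] at h2 ⊢
      exact (hFy y).trans_lt h2
    simp [this]
  · have hc : ContinuousAt (fun x : Eu n => ‖x‖ ^ (-a)) x :=
      continuous_norm.continuousAt.rpow_const (Or.inl (norm_ne_zero_iff.2 hx0))
    exact (surf_finiteAt M (hKM hx)).integrableAtFilter_of_tendsto
      hmeas.stronglyMeasurable.stronglyMeasurableAtFilter hc.tendsto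

open IsChart

theorem dv_smul_id (M : Hypersurface n) {s : Eu n → ℝ} {x : Eu n} {L : Eu n →L[ℝ] ℝ}
    (hs : HasFDerivAt s L x) (hx : x ∈ M.carrier) :
    dv M (fun x => s x • x) x = n * s x + L x - L (M.nu x) * ⟪x, M.nu x⟫
      - meanCurv M x * (s x * ⟪x, M.nu x⟫) := by
  have hZ : HasFDerivAt (fun x => s x • x) (s x • ContinuousLinearMap.id ℝ (Eu n) + L.smulRight x) x :=
    hs.fun_smul (hasFDerivAt_id x)
  have hu : ⟪M.nu x, M.nu x⟫ = 1 := by rw [real_inner_self_eq_norm_sq, M.unit_nu x hx]; norm_num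
  rw [dv, tdiv_eq _ _ _ hZ.differentiableAt, hZ.fderiv]
  have htr : LinearMap.trace ℝ _ (s x • ContinuousLinearMap.id ℝ (Eu n) + L.smulRight x).toLinearMap
      = s x * (n + 1) + L x := by
    have : (s x • ContinuousLinearMap.id ℝ (Eu n) + L.smulRight x).toLinearMap
      = s x • LinearMap.id + L.toLinearMap.smulRight x := rfl
    rw [this, map_add, map_smul, LinearMap.trace_id, LinearMap.trace_smulRight]
    simp
  rw [htr]
  simp only [_root_.add_apply, _root_.smul_apply, ContinuousLinearMap.id_apply,
    ContinuousLinearMap.smulRight_apply, inner_add_left, real_inner_smul_left, hu]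
  ring

theorem hasFDerivAt_weight {φ : Eu n → ℝ} (hφ : ContDiff ℝ 1 φ) (a : ℝ) {ε : ℝ} (hε : 0 < ε)
    (x : Eu n) :
    HasFDerivAt (fun x => φ x ^ 2 * (‖x‖ ^ 2 + ε) ^ (-a / 2))
      ((2 * φ x * (‖x‖ ^ 2 + ε) ^ (-a / 2)) • innerSL ℝ (gradient φ x)
        - (a * φ x ^ 2 * (‖x‖ ^ 2 + ε) ^ (-a / 2 - 1)) • innerSL ℝ x) x := by
  have h1 : HasFDerivAt φ (innerSL ℝ (gradient φ x)) x :=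
    (hφ.differentiable (by simp) x).hasGradientAt.hasFDerivAt
  have h2 : HasFDerivAt (fun x : Eu n => ‖x‖ ^ 2 + ε) (2 • innerSL ℝ x) x :=
    ((hasStrictFDerivAt_norm_sq x).hasFDerivAt).add_const ε
  have h3 := h2.rpow_const (p := -a / 2) (Or.inl (by positivity))
  refine ((h1.pow 2).mul h3).congr_fderiv ?_
  ext z
  simp
  ring

theorem contDiff_weight {φ : Eu n → ℝ} (hφ : ContDiff ℝ 1 φ) (a : ℝ) {ε : ℝ} (hε : 0 < ε) :
    ContDiff ℝ 1 (fun x : Eu n => (φ x ^ 2 * (‖x‖ ^ 2 + ε) ^ (-a / 2)) • x) := by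
  have h2 : ContDiff ℝ 1 (fun x : Eu n => ‖x‖ ^ 2 + ε) := (contDiff_norm_sq ℝ).add contDiff_const
  exact ((hφ.pow 2).mul (h2.rpow_const_of_ne (fun x => by positivity))).smul contDiff_id

/-- The energy density. -/
def Qd (M : Hypersurface n) (φ : Eu n → ℝ) (x : Eu n) : ℝ :=
  4 * ‖tgrad M.nu φ x‖ ^ 2 + (meanCurv M x * φ x) ^ 2

theorem Qd_nonneg (M : Hypersurface n) (φ : Eu n → ℝ) (x : Eu n) : 0 ≤ Qd M φ x := by
  unfold Qd; positivity

theorem inner_tgrad (M : Hypersurface n) (φ : Eu n → ℝ) {x : Eu n} (hx : x ∈ M.carrier) :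
    ⟪tgrad M.nu φ x, M.nu x⟫ = 0 := by
  have hu : ⟪M.nu x, M.nu x⟫ = 1 := by rw [real_inner_self_eq_norm_sq, M.unit_nu x hx]; norm_num
  rw [tgrad, inner_sub_left, real_inner_smul_left, hu]; ring

theorem Qd_eq (M : Hypersurface n) (φ : Eu n → ℝ) {x : Eu n} (hx : x ∈ M.carrier) :
    ‖(2 : ℝ) • tgrad M.nu φ x - (meanCurv M x * φ x) • M.nu x‖ = √(Qd M φ x) := by
  rw [eq_comm, Real.sqrt_eq_iff_eq_sq (Qd_nonneg M φ x) (norm_nonneg _), norm_sub_sq_real,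
    real_inner_smul_left, real_inner_smul_right, inner_tgrad M φ hx, norm_smul, norm_smul,
    M.unit_nu x hx, Qd, Real.norm_eq_abs, Real.norm_eq_abs]
  simp only [mul_pow, sq_abs]
  ring

/-- The lower bound of the divergence. -/
def hd (M : Hypersurface n) (a : ℝ) (φ : Eu n → ℝ) (ε : ℝ) (x : Eu n) : ℝ :=
  (n - a) * (φ x ^ 2 * (‖x‖ ^ 2 + ε) ^ (-a / 2))
    + a * (⟪x, M.nu x⟫ ^ 2 * (φ x ^ 2 * (‖x‖ ^ 2 + ε) ^ (-a / 2 - 1)))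
    - |φ x| * (‖x‖ * √(Qd M φ x)) * (‖x‖ ^ 2 + ε) ^ (-a / 2)

theorem hd_le (M : Hypersurface n) {a : ℝ} (ha : 0 ≤ a) {φ : Eu n → ℝ} (hφ : ContDiff ℝ 1 φ)
    {ε : ℝ} (hε : 0 < ε) {x : Eu n} (hx : x ∈ M.carrier) :
    hd M a φ ε x ≤ dv M (fun x => (φ x ^ 2 * (‖x‖ ^ 2 + ε) ^ (-a / 2)) • x) x := by
  rw [dv_smul_id M (hasFDerivAt_weight hφ a hε x) hx, hd]
  have hw : (‖x‖ ^ 2 + ε) ^ (-a / 2) = (‖x‖ ^ 2 + ε) ^ (-a / 2 - 1) * (‖x‖ ^ 2 + ε) := by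
    rw [Real.rpow_sub_one (by positivity)]
    field_simp
  have hw2 : 0 ≤ (‖x‖ ^ 2 + ε) ^ (-a / 2 - 1) := by positivity
  have hw0 : 0 ≤ (‖x‖ ^ 2 + ε) ^ (-a / 2) := by positivity
  have hcs := abs_real_inner_le_norm x ((2 : ℝ) • tgrad M.nu φ x - (meanCurv M x * φ x) • M.nu x)
  rw [Qd_eq M φ hx] at hcs
  have hin : ⟪x, (2 : ℝ) • tgrad M.nu φ x - (meanCurv M x * φ x) • M.nu x⟫
      = 2 * (⟪gradient φ x, x⟫ - ⟪gradient φ x, M.nu x⟫ * ⟪x, M.nu x⟫)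
        - meanCurv M x * φ x * ⟪x, M.nu x⟫ := by
    rw [tgrad, inner_sub_right, real_inner_smul_right, real_inner_smul_right, inner_sub_right,
      real_inner_smul_right, real_inner_comm x]
  rw [hin] at hcs
  simp only [_root_.sub_apply, _root_.smul_apply, innerSL_apply_apply,
    smul_eq_mul, real_inner_self_eq_norm_sq]
  set I := 2 * (⟪gradient φ x, x⟫ - ⟪gradient φ x, M.nu x⟫ * ⟪x, M.nu x⟫)
        - meanCurv M x * φ x * ⟪x, M.nu x⟫ with hI
  have h1 : -(|φ x| * (‖x‖ * √(Qd M φ x))) ≤ φ x * I := by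
    have : |φ x * I| ≤ |φ x| * (‖x‖ * √(Qd M φ x)) := by
      rw [abs_mul]; exact mul_le_mul_of_nonneg_left hcs (abs_nonneg _)
    linarith [neg_abs_le (φ x * I)]
  have h2 := mul_le_mul_of_nonneg_right h1 hw0
  have h3 : 0 ≤ a * φ x ^ 2 * ((‖x‖ ^ 2 + ε) ^ (-a / 2 - 1) * ε) := by positivity
  have h4 : (‖x‖ ^ 2 + ε) ^ (-a / 2 - 1) * ε
    = (‖x‖ ^ 2 + ε) ^ (-a / 2) - (‖x‖ ^ 2 + ε) ^ (-a / 2 - 1) * ‖x‖ ^ 2 := by rw [hw]; ring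
  rw [h4] at h3
  rw [hI] at h2
  clear_value I
  nlinarith [h2, h3]

theorem continuous_meanCurv (M : Hypersurface n) : Continuous (meanCurv M) := by
  have h1 : Continuous (fun x => fderiv ℝ M.nu x) := M.smooth_nu.continuous_fderiv (by simp)
  have h0 : Continuous M.nu := M.smooth_nu.continuous
  have heq : meanCurv M = fun x => LinearMap.trace ℝ _ (fderiv ℝ M.nu x).toLinearMap
      - ⟪fderiv ℝ M.nu x (M.nu x), M.nu x⟫ := by
    ext x
    exact tdiv_eq _ _ _ (M.smooth_nu.differentiable (by simp) x)
  rw [heq]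
  have h2 : Continuous (fun L : Eu n →L[ℝ] Eu n => LinearMap.trace ℝ _ L.toLinearMap) :=
    LinearMap.continuous_of_finiteDimensional
      ((LinearMap.trace ℝ (Eu n)).comp (ContinuousLinearMap.coeLM ℝ))
  exact (h2.comp h1).sub ((h1.clm_apply h0).inner h0)

theorem continuous_tgrad (M : Hypersurface n) {φ : Eu n → ℝ} (hφ : ContDiff ℝ 1 φ) :
    Continuous (tgrad M.nu φ) := by
  have h0 : Continuous M.nu := M.smooth_nu.continuous
  have h1 : Continuous (fun x => gradient φ x) :=
    (InnerProductSpace.toDual ℝ (Eu n)).symm.continuous.comp (hφ.continuous_fderiv (by simp))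
  unfold tgrad
  fun_prop

theorem continuous_Qd (M : Hypersurface n) {φ : Eu n → ℝ} (hφ : ContDiff ℝ 1 φ) :
    Continuous (Qd M φ) := by
  have h0 := continuous_tgrad M hφ
  have h1 := continuous_meanCurv M
  have h2 := hφ.continuous
  unfold Qd
  fun_prop

theorem Qd_eq_zero (M : Hypersurface n) {φ : Eu n → ℝ} (hφ : ContDiff ℝ 1 φ) {K : Set (Eu n)}
    (hK : IsCompact K) (h0 : ∀ x ∈ M.carrier, x ∉ K → φ x = 0) {x : Eu n} (hx : x ∈ M.carrier)
    (hxK : x ∉ K) : Qd M φ x = 0 := by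
  obtain ⟨G, U, h, hxU⟩ := exists_chart M x hx
  have h1 := h.fderiv_eq_zero hx hxU (hφ.differentiable (by simp) x)
    (by filter_upwards [hK.isClosed.isOpen_compl.mem_nhds hxK] with y hy hyM using h0 y hyM hy)
    (inner_tgrad M φ hx)
  have h2 : fderiv ℝ φ x (tgrad M.nu φ x) = ⟪gradient φ x, tgrad M.nu φ x⟫ := by
    rw [(hφ.differentiable (by simp) x).hasGradientAt.hasFDerivAt.fderiv]; rfl
  have h3 : ‖tgrad M.nu φ x‖ ^ 2 = 0 := by
    rw [← real_inner_self_eq_norm_sq]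
    nth_rewrite 1 [tgrad]
    rw [inner_sub_left, real_inner_smul_left, ← h2, h1, real_inner_comm (tgrad M.nu φ x), inner_tgrad M φ hx]
    simp
  rw [Qd, h3, h0 x hx hxK]; simp

theorem ae_ne_zero (M : Hypersurface n) (hn : (0 : ℝ) < n) :
    ∀ᵐ x ∂(surfMeasure M), x ∈ M.carrier ∧ x ≠ 0 := by
  have hno : NullSingletonClass (μH[(n : ℝ)] : Measure (Eu n)) :=
    Measure.nullSingletonClass_hausdorff _ hn
  have hne : ∀ᵐ y ∂(surfMeasure M), y ≠ 0 :=
    ae_restrict_of_ae (by simp only [ae_iff, not_not]; exact measure_singleton 0)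
  filter_upwards [hne, ae_restrict_mem (measurableSet_carrier M)] with x h1 h2 using ⟨h2, h1⟩

theorem integrable_bd (M : Hypersurface n) {a : ℝ} (ha : 0 ≤ a) (han : a < n) {K : Set (Eu n)}
    (hK : IsCompact K) (hKM : K ⊆ M.carrier) (C : ℝ) :
    Integrable (K.indicator (fun x => C * ‖x‖ ^ (-a))) (surfMeasure M) := by
  rw [integrable_indicator_iff hK.measurableSet]
  exact (weight_integrableOn M ha han hK hKM).const_mul C

theorem integrable_of_bd (M : Hypersurface n) {a : ℝ} (ha : 0 ≤ a) (han : a < n) {K : Set (Eu n)}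
    (hK : IsCompact K) (hKM : K ⊆ M.carrier) {g : Eu n → ℝ} (hg : Measurable g)
    {c : Eu n → ℝ} (hc : Continuous c)
    (h0 : ∀ x ∈ M.carrier, x ∉ K → g x = 0) (hb : ∀ x, x ≠ 0 → |g x| ≤ c x * ‖x‖ ^ (-a)) :
    Integrable g (surfMeasure M) := by
  obtain ⟨C, hC⟩ := hK.exists_bound_of_continuousOn hc.continuousOn
  refine (integrable_bd M ha han hK hKM C).mono' hg.aestronglyMeasurable ?_
  filter_upwards [ae_ne_zero M (ha.trans_lt han)] with x ⟨hx, hx0⟩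
  by_cases hxK : x ∈ K
  · rw [Set.indicator_of_mem hxK]
    exact (hb x hx0).trans (mul_le_mul_of_nonneg_right ((le_abs_self _).trans (hC x hxK)) (by positivity))
  · rw [h0 x hx hxK, Set.indicator_of_notMem hxK]; simp

open IsChart

/-- The dominating density. -/
def cd (M : Hypersurface n) (a : ℝ) (φ : Eu n → ℝ) (x : Eu n) : ℝ :=
  (n - a) * φ x ^ 2 + a * (‖M.nu x‖ ^ 2 * φ x ^ 2) + |φ x| * (‖x‖ * √(Qd M φ x))

theorem continuous_cd (M : Hypersurface n) (a : ℝ) {φ : Eu n → ℝ} (hφ : ContDiff ℝ 1 φ) :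
    Continuous (cd M a φ) := by
  have h0 := continuous_Qd M hφ
  have h1 := hφ.continuous
  have h2 := M.smooth_nu.continuous
  unfold cd
  fun_prop

theorem measurable_hd (M : Hypersurface n) (a : ℝ) {φ : Eu n → ℝ} (hφ : ContDiff ℝ 1 φ) (ε : ℝ) :
    Measurable (hd M a φ ε) := by
  have h0 := (continuous_Qd M hφ).measurable
  have h1 := hφ.continuous.measurable
  have h2 : Measurable (fun x => ⟪x, M.nu x⟫) :=
    (continuous_id.inner M.smooth_nu.continuous).measurable
  unfold hd
  fun_prop

theorem abs_hd_le (M : Hypersurface n) {a : ℝ} (ha : 0 ≤ a) (han : a < n) (φ : Eu n → ℝ) {ε : ℝ}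
    (hε : 0 ≤ ε) {x : Eu n} (hx : x ≠ 0) :
    |hd M a φ ε x| ≤ cd M a φ x * ‖x‖ ^ (-a) := by
  have hr : 0 < ‖x‖ := norm_pos_iff.2 hx
  have hw : (‖x‖ ^ 2 + ε) ^ (-a / 2) = (‖x‖ ^ 2 + ε) ^ (-a / 2 - 1) * (‖x‖ ^ 2 + ε) := by
    rw [Real.rpow_sub_one (by positivity)]
    field_simp
  have hle : (‖x‖ ^ 2 + ε) ^ (-a / 2) ≤ ‖x‖ ^ (-a) := by
    calc (‖x‖ ^ 2 + ε) ^ (-a / 2) ≤ (‖x‖ ^ 2) ^ (-a / 2) :=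
          Real.rpow_le_rpow_of_nonpos (by positivity) (by linarith) (by linarith)
      _ = ‖x‖ ^ (-a) := by
          rw [← Real.rpow_natCast, ← Real.rpow_mul hr.le]; congr 1; push_cast; ring
  have hw2 : 0 ≤ (‖x‖ ^ 2 + ε) ^ (-a / 2 - 1) := by positivity
  have hw0 : 0 ≤ (‖x‖ ^ 2 + ε) ^ (-a / 2) := by positivity
  have hi : ⟪x, M.nu x⟫ ^ 2 ≤ ‖x‖ ^ 2 * ‖M.nu x‖ ^ 2 := by
    rw [← mul_pow, ← sq_abs]
    exact pow_le_pow_left₀ (abs_nonneg _) (abs_real_inner_le_norm _ _) 2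
  have h2 : ⟪x, M.nu x⟫ ^ 2 * (φ x ^ 2 * (‖x‖ ^ 2 + ε) ^ (-a / 2 - 1))
      ≤ ‖M.nu x‖ ^ 2 * φ x ^ 2 * ‖x‖ ^ (-a) := by
    calc _ ≤ (‖x‖ ^ 2 * ‖M.nu x‖ ^ 2) * (φ x ^ 2 * (‖x‖ ^ 2 + ε) ^ (-a / 2 - 1)) :=
          mul_le_mul_of_nonneg_right hi (by positivity)
      _ = ‖M.nu x‖ ^ 2 * φ x ^ 2 * ((‖x‖ ^ 2 + ε) ^ (-a / 2 - 1) * ‖x‖ ^ 2) := by ring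
      _ ≤ ‖M.nu x‖ ^ 2 * φ x ^ 2 * ((‖x‖ ^ 2 + ε) ^ (-a / 2 - 1) * (‖x‖ ^ 2 + ε)) := by
          gcongr; linarith
      _ ≤ _ := by rw [← hw]; gcongr
  have hna : 0 ≤ (n : ℝ) - a := by linarith
  have A1 : 0 ≤ ((n : ℝ) - a) * (φ x ^ 2 * (‖x‖ ^ 2 + ε) ^ (-a / 2)) := by positivity
  have A2 : 0 ≤ a * (⟪x, M.nu x⟫ ^ 2 * (φ x ^ 2 * (‖x‖ ^ 2 + ε) ^ (-a / 2 - 1))) := by positivity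
  have A3 : 0 ≤ |φ x| * (‖x‖ * √(Qd M φ x)) * (‖x‖ ^ 2 + ε) ^ (-a / 2) := by positivity
  have B1 : ((n : ℝ) - a) * (φ x ^ 2 * (‖x‖ ^ 2 + ε) ^ (-a / 2))
      ≤ ((n : ℝ) - a) * (φ x ^ 2 * ‖x‖ ^ (-a)) := by gcongr
  have B2 := mul_le_mul_of_nonneg_left h2 ha
  have B3 : |φ x| * (‖x‖ * √(Qd M φ x)) * (‖x‖ ^ 2 + ε) ^ (-a / 2)
    ≤ |φ x| * (‖x‖ * √(Qd M φ x)) * ‖x‖ ^ (-a) := by gcongr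
  have e : cd M a φ x * ‖x‖ ^ (-a) = ((n : ℝ) - a) * (φ x ^ 2 * ‖x‖ ^ (-a))
    + a * (‖M.nu x‖ ^ 2 * φ x ^ 2 * ‖x‖ ^ (-a)) + |φ x| * (‖x‖ * √(Qd M φ x)) * ‖x‖ ^ (-a) := by
    rw [cd]; ring
  rw [e, hd, abs_le]
  constructor <;> linarith

theorem hd_eq_zero (M : Hypersurface n) (a : ℝ) {φ : Eu n → ℝ} (ε : ℝ) {x : Eu n}
    (h : φ x = 0) : hd M a φ ε x = 0 := by
  simp [hd, h]

theorem integral_hd_nonpos (M : Hypersurface n) {a : ℝ} (ha : 0 ≤ a) (han : a < n)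
    {φ : Eu n → ℝ} (hφ : ContDiff ℝ 1 φ) {K : Set (Eu n)}
    (hK : IsCompact K) (hKM : K ⊆ M.carrier) (h0 : ∀ x ∈ M.carrier, x ∉ K → φ x = 0) :
    ∫ x, hd M a φ 0 x ∂(surfMeasure M) ≤ 0 := by
  obtain ⟨C, hC⟩ := hK.exists_bound_of_continuousOn (continuous_cd M a hφ).continuousOn
  have hlim : Filter.Tendsto (fun k : ℕ => ∫ x, hd M a φ (1 / ((k : ℝ) + 1)) x ∂(surfMeasure M))
      Filter.atTop (nhds (∫ x, hd M a φ 0 x ∂(surfMeasure M))) := by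
    refine tendsto_integral_of_dominated_convergence _
      (fun k => (measurable_hd M a hφ _).aestronglyMeasurable) (integrable_bd M ha han hK hKM C) ?_ ?_
    · intro k
      filter_upwards [ae_ne_zero M (ha.trans_lt han)] with x ⟨hx, hx0⟩
      by_cases hxK : x ∈ K
      · rw [Set.indicator_of_mem hxK]
        exact (abs_hd_le M ha han φ (by positivity) hx0).trans
          (mul_le_mul_of_nonneg_right ((le_abs_self _).trans (hC x hxK)) (by positivity))
      · rw [hd_eq_zero M a _ (h0 x hx hxK), Set.indicator_of_notMem hxK]; simp
    · filter_upwards [ae_ne_zero M (ha.trans_lt han)] with x ⟨hx, hx0⟩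
      have hr : 0 < ‖x‖ := norm_pos_iff.2 hx0
      have hcont : ContinuousAt (fun ε => hd M a φ ε x) 0 := by
        have hb : ∀ p : ℝ, ContinuousAt (fun ε : ℝ => (‖x‖ ^ 2 + ε) ^ p) 0 := fun p =>
          ContinuousAt.rpow_const (by fun_prop) (Or.inl (by simp; exact hx0))
        have h1 := hb (-a / 2)
        have h2 := hb (-a / 2 - 1)
        unfold hd
        fun_prop
      exact hcont.tendsto.comp tendsto_one_div_add_atTop_nhds_zero_nat
  refine le_of_tendsto' hlim fun k => ?_
  have hε : (0 : ℝ) < 1 / ((k : ℝ) + 1) := by positivity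
  obtain ⟨hi, h1⟩ := global_div M (contDiff_weight hφ a hε) hK hKM
    (fun x hx hxK => by simp [h0 x hx hxK])
  rw [← h1]
  refine integral_mono_ae (integrable_of_bd M ha han hK hKM (measurable_hd M a hφ _)
    (continuous_cd M a hφ) (fun x hx hxK => hd_eq_zero M a _ (h0 x hx hxK))
    (fun x hx => abs_hd_le M ha han φ hε.le hx)) hi ?_
  filter_upwards [ae_ne_zero M (ha.trans_lt han)] with x ⟨hx, hx0⟩ using hd_le M ha hφ hε hx

theorem hardy_aux (M : Hypersurface n) (a : ℝ) (ha : 0 ≤ a) (han : a < n)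
    (φ : Eu n → ℝ) (hφ' : C1cOn M.carrier φ) :
    ((n : ℝ) - a) * ∫ x, φ x ^ 2 / ‖x‖ ^ a ∂surfMeasure M
      + a * ∫ x, (⟪x, M.nu x⟫ / ‖x‖) ^ 2 * (φ x ^ 2 / ‖x‖ ^ a) ∂surfMeasure M
    ≤ (∫ x, φ x ^ 2 / ‖x‖ ^ a ∂surfMeasure M) ^ ((1 : ℝ) / 2)
      * (∫ x, Qd M φ x / ‖x‖ ^ (a - 2) ∂surfMeasure M) ^ ((1 : ℝ) / 2) := by
  obtain ⟨hφ, K, hK, hKM, h0⟩ := hφ'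
  have hne := ae_ne_zero M (ha.trans_lt han)
  have mQ := (continuous_Qd M hφ).measurable
  have mφ := hφ.continuous.measurable
  have mi : Measurable (fun x => ⟪x, M.nu x⟫) :=
    (continuous_id.inner M.smooth_nu.continuous).measurable
  set F : Eu n → ℝ := fun x => |φ x| * ‖x‖ ^ (-a / 2) with hF
  set G : Eu n → ℝ := fun x => √(Qd M φ x) * ‖x‖ * ‖x‖ ^ (-a / 2) with hG
  have mF : Measurable F := by fun_prop
  have mG : Measurable G := by fun_prop
  have hu : ∀ x : Eu n, x ≠ 0 → (‖x‖ ^ (-a / 2)) ^ 2 = ‖x‖ ^ (-a) := fun x hx => by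
    rw [← Real.rpow_natCast, ← Real.rpow_mul (norm_nonneg x)]; congr 1; push_cast; ring
  have hF2 : ∀ x : Eu n, x ≠ 0 → F x ^ 2 = φ x ^ 2 * ‖x‖ ^ (-a) := fun x hx => by
    rw [hF]; simp only []; rw [mul_pow, sq_abs, hu x hx]
  have hG2 : ∀ x : Eu n, x ≠ 0 → G x ^ 2 = (Qd M φ x * ‖x‖ ^ 2) * ‖x‖ ^ (-a) := fun x hx => by
    rw [hG]; simp only []; rw [mul_pow, mul_pow, Real.sq_sqrt (Qd_nonneg M φ x), hu x hx]
  have iF2 : Integrable (fun x => F x ^ 2) (surfMeasure M) := by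
    refine integrable_of_bd M ha han hK hKM (mF.pow_const 2) (hφ.continuous.pow 2)
      (fun x hx hxK => by simp [hF, h0 x hx hxK]) (fun x hx => ?_)
    rw [hF2 x hx, abs_of_nonneg (by positivity)]; exact le_rfl
  have iG2 : Integrable (fun x => G x ^ 2) (surfMeasure M) := by
    refine integrable_of_bd M ha han hK hKM (mG.pow_const 2)
      ((continuous_Qd M hφ).mul (continuous_norm.pow 2))
      (fun x hx hxK => by simp [hG, Qd_eq_zero M hφ hK h0 hx hxK]) (fun x hx => ?_)
    have := Qd_nonneg M φ x
    rw [hG2 x hx, abs_of_nonneg (by positivity)]; exact le_rfl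
  have LF : MemLp F 2 (surfMeasure M) := (memLp_two_iff_integrable_sq mF.aestronglyMeasurable).2 iF2
  have LG : MemLp G 2 (surfMeasure M) := (memLp_two_iff_integrable_sq mG.aestronglyMeasurable).2 iG2
  have iFG : Integrable (fun x => F x * G x) (surfMeasure M) := LF.integrable_mul LG
  have hol := integral_mul_le_Lp_mul_Lq_of_nonneg (μ := surfMeasure M) Real.HolderConjugate.two_two
    (f := F) (g := G)
    (Filter.Eventually.of_forall fun x => by simp only [hF, Pi.zero_apply]; positivity)
    (Filter.Eventually.of_forall fun x => by simp only [hG, Pi.zero_apply]; positivity)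
    (by simpa using LF) (by simpa using LG)
  simp only [Real.rpow_two] at hol
  have ha' : ∀ x : Eu n, ‖x‖ ^ (-a) = (‖x‖ ^ a)⁻¹ := fun x => Real.rpow_neg (norm_nonneg x) a
  have eF : ∫ x, F x ^ 2 ∂(surfMeasure M) = ∫ x, φ x ^ 2 / ‖x‖ ^ a ∂surfMeasure M := by
    refine integral_congr_ae ?_
    filter_upwards [hne] with x ⟨_, hx0⟩
    rw [hF2 x hx0, ha', div_eq_mul_inv]
  have eG : ∫ x, G x ^ 2 ∂(surfMeasure M) = ∫ x, Qd M φ x / ‖x‖ ^ (a - 2) ∂surfMeasure M := by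
    refine integral_congr_ae ?_
    filter_upwards [hne] with x ⟨_, hx0⟩
    have hr : 0 < ‖x‖ := norm_pos_iff.2 hx0
    rw [hG2 x hx0, ha', Real.rpow_sub hr, Real.rpow_two]
    field_simp
  rw [eF, eG] at hol
  refine le_trans ?_ hol
  have i1 : Integrable (fun x => φ x ^ 2 / ‖x‖ ^ a) (surfMeasure M) := by
    refine iF2.congr ?_
    filter_upwards [hne] with x ⟨_, hx0⟩
    rw [hF2 x hx0, ha', div_eq_mul_inv]
  have i2 : Integrable (fun x => (⟪x, M.nu x⟫ / ‖x‖) ^ 2 * (φ x ^ 2 / ‖x‖ ^ a)) (surfMeasure M) := by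
    refine i1.mono' (by fun_prop) ?_
    filter_upwards [hne] with x ⟨hx, hx0⟩
    rw [Real.norm_of_nonneg (by positivity)]
    refine mul_le_of_le_one_left (by positivity) ?_
    rw [sq_le_one_iff_abs_le_one, abs_div, abs_norm]
    refine div_le_one_of_le₀ ?_ (norm_nonneg _)
    simpa [M.unit_nu x hx] using abs_real_inner_le_norm x (M.nu x)
  have hmain := integral_hd_nonpos M ha han hφ hK hKM h0
  have e0 : ∫ x, hd M a φ 0 x ∂(surfMeasure M) = ∫ x, ((((n : ℝ) - a) * (φ x ^ 2 / ‖x‖ ^ a)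
      + a * ((⟪x, M.nu x⟫ / ‖x‖) ^ 2 * (φ x ^ 2 / ‖x‖ ^ a))) - F x * G x) ∂(surfMeasure M) := by
    refine integral_congr_ae ?_
    filter_upwards [hne] with x ⟨_, hx0⟩
    have hr : 0 < ‖x‖ := norm_pos_iff.2 hx0
    have hw : (‖x‖ ^ 2) ^ (-a / 2) = ‖x‖ ^ (-a) := by
      rw [← Real.rpow_natCast, ← Real.rpow_mul hr.le]; congr 1; push_cast; ring
    have hFG : F x * G x = |φ x| * (‖x‖ * √(Qd M φ x)) * (‖x‖ ^ (-a / 2)) ^ 2 := by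
      simp only [hF, hG]; ring
    rw [hFG, hu x hx0, hd, add_zero, Real.rpow_sub_one (by positivity), hw, ha']
    field_simp
  rw [e0, integral_sub ((i1.const_mul _).fun_add (i2.const_mul _)) iFG,
    integral_add (i1.const_mul _) (i2.const_mul _), integral_const_mul, integral_const_mul] at hmain
  linarith

/-- Hardy inequality on hypersurfaces with exponent `2` and `a ∈ [0,n)`. -/
theorem hardy_ibp_two (M : Hypersurface n) (a : ℝ) (ha : 0 ≤ a) (han : a < n)
    (φ : Eu n → ℝ) (hφ : C1cOn M.carrier φ) :
    ((n : ℝ) - a) * ∫ x, φ x ^ 2 / ‖x‖ ^ a ∂surfMeasure M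
      + a * ∫ x, (⟪x, M.nu x⟫ / ‖x‖) ^ 2 * (φ x ^ 2 / ‖x‖ ^ a) ∂surfMeasure M
    ≤ (∫ x, φ x ^ 2 / ‖x‖ ^ a ∂surfMeasure M) ^ ((1 : ℝ) / 2)
      * (∫ x, (4 * ‖tgrad M.nu φ x‖ ^ 2 + (meanCurv M x * φ x) ^ 2) / ‖x‖ ^ (a - 2)
          ∂surfMeasure M) ^ ((1 : ℝ) / 2) := by
  exact hardy_aux M a ha han φ hφ
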